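/- arXiv:2605.01213 — 4 statements merged into one kernel-verified Lean document; each statement's English description precedes it below -/
import Mathlib

section
/- Let w ≥ 3 be an integer, let δ ∈ (0,1/2), and set ρ = 1/2 − √(δ(1−δ)). Then R_w(δ) ≤ H(ρ) − (1/w) log₂(1 + (ρ/(1−ρ))^w). -/
/-- The dual code `C⊥ = {x ∈ F₂ⁿ : x·c = 0 for all c ∈ C}`. -/
noncomputable def dualCode {n : ℕ} (C : Submodule (ZMod 2) (Fin n → ZMod 2)) :
    Submodule (ZMod 2) (Fin n → ZMod 2) where
  carrier := {x | ∀ c ∈ C, ∑ i, x i * c i = 0}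
  zero_mem' := by intro c hc; simp
  add_mem' := by
    intro a b ha hb c hc
    have h1 := ha c hc
    have h2 := hb c hc
    simp only [Pi.add_apply, add_mul, Finset.sum_add_distrib, h1, h2, add_zero]
  smul_mem' := by
    intro r a ha c hc
    have h := ha c hc
    simp only [Pi.smul_apply, smul_eq_mul, mul_assoc, ← Finset.mul_sum, h, mul_zero]
/-- `A_w(n,δ)`: the maximum cardinality of a linear code `C ≤ F₂ⁿ` whose dual `C⊥` is
spanned by vectors of Hamming weight at most `w` and whose minimum Hamming distance is
at least `δn`. -/
noncomputable def maxLDPCCard (w n : ℕ) (δ : ℝ) : ℕ :=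
  sSup {k | ∃ C : Submodule (ZMod 2) (Fin n → ZMod 2),
    (∃ S : Set (Fin n → ZMod 2), (∀ x ∈ S, hammingNorm x ≤ w) ∧
      Submodule.span (ZMod 2) S = dualCode C) ∧
    (∀ c ∈ C, c ≠ 0 → δ * n ≤ (hammingNorm c : ℝ)) ∧
    Nat.card C = k}

/-- `R_w(δ) = limsup_{n→∞} (1/n) log₂ A_w(n,δ)`. -/
noncomputable def LDPCRate (w : ℕ) (δ : ℝ) : ℝ :=
  Filter.limsup (fun n : ℕ => Real.logb 2 (maxLDPCCard w n δ) / n) Filter.atTop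

/-- The binary entropy function `H(x) = −x log₂ x − (1−x) log₂ (1−x)`. -/
noncomputable def binEnt (x : ℝ) : ℝ := -x * Real.logb 2 x - (1 - x) * Real.logb 2 (1 - x)

section BinaryCodes

open Finset

variable {n : ℕ}

theorem dualCode_eq_orthogonal (C : Submodule (ZMod 2) (Fin n → ZMod 2)) :
    dualCode C =
      LinearMap.BilinForm.orthogonal (dotProductBilin (ZMod 2) (ZMod 2) (m := Fin n)) C := by
  ext x
  refine forall₂_congr fun c _ => ?_
  simp only [dotProductBilin_apply_apply, dotProduct, mul_comm]

theorem dotProductBilin_isRefl :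
    LinearMap.BilinForm.IsRefl (dotProductBilin (ZMod 2) (ZMod 2) (m := Fin n)) := by
  intro x y h
  simpa [dotProductBilin_apply_apply, dotProduct_comm] using h

theorem dotProductBilin_nondegenerate :
    LinearMap.BilinForm.Nondegenerate (dotProductBilin (ZMod 2) (ZMod 2) (m := Fin n)) := by
  refine (LinearMap.IsRefl.nondegenerate_iff_separatingLeft dotProductBilin_isRefl).2 ?_
  intro x hx
  exact dotProduct_eq_zero x fun y => hx y

theorem dualCode_dualCode (C : Submodule (ZMod 2) (Fin n → ZMod 2)) :
    dualCode (dualCode C) = C := by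
  rw [dualCode_eq_orthogonal, dualCode_eq_orthogonal]
  exact LinearMap.BilinForm.orthogonal_orthogonal dotProductBilin_nondegenerate
    dotProductBilin_isRefl C

theorem card_mul_card_dualCode (C : Submodule (ZMod 2) (Fin n → ZMod 2)) :
    Nat.card C * Nat.card (dualCode C) = 2 ^ n := by
  have h := LinearMap.BilinForm.finrank_orthogonal dotProductBilin_nondegenerate C
  rw [← dualCode_eq_orthogonal, Module.finrank_fin_fun] at h
  have hle := Submodule.finrank_le C
  rw [Module.finrank_fin_fun] at hle
  rw [Module.natCard_eq_pow_finrank (K := ZMod 2) (V := C),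
    Module.natCard_eq_pow_finrank (K := ZMod 2) (V := dualCode C), ← pow_add, h,
    Nat.card_zmod, Nat.add_sub_cancel' hle]

theorem hammingNorm_add_le (x y : Fin n → ZMod 2) :
    hammingNorm (x + y) ≤ hammingNorm x + hammingNorm y := by
  refine (card_le_card fun i hi => ?_).trans (card_union_le _ _)
  simp only [mem_union, mem_filter, mem_univ, true_and, Pi.add_apply] at hi ⊢
  by_contra! h
  simp [h.1, h.2] at hi

theorem add_self_eq_zero_binary (x : Fin n → ZMod 2) : x + x = 0 := by
  ext i
  exact CharTwo.add_self_eq_zero _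

/-- Flipping a coordinate changes the Hamming weight by one. -/
theorem hammingNorm_add_single (y : Fin n → ZMod 2) (i : Fin n) :
    hammingNorm (y + Pi.single i 1) =
      if y i ≠ 0 then hammingNorm y - 1 else hammingNorm y + 1 := by
  have h01 : ∀ a : ZMod 2, a + 1 ≠ 0 ↔ a = 0 := by decide
  split_ifs with h
  · rw [hammingNorm, hammingNorm, ← card_erase_of_mem (a := i) (by simpa using h)]
    congr 1
    ext j
    by_cases hj : j = i
    · subst hj; simpa [h01] using h
    · simp [hj]
  · rw [hammingNorm, hammingNorm, ← card_insert_of_notMem (a := i) (by simpa using h)]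
    congr 1
    ext j
    by_cases hj : j = i
    · subst hj; simpa [h01] using h
    · simp [hj]

theorem sum_pow_hammingNorm (z : ℝ) :
    ∑ x : Fin n → ZMod 2, z ^ hammingNorm x = (1 + z) ^ n := by
  have h : ∀ x : Fin n → ZMod 2, z ^ hammingNorm x = ∏ i, if x i ≠ 0 then z else 1 := by
    intro x
    rw [prod_ite, prod_const, prod_const_one, mul_one, hammingNorm]
  have h2 : ∑ a : ZMod 2, (if a ≠ 0 then z else 1) = 1 + z := by
    change ∑ a : Fin 2, (if (a : ZMod 2) ≠ 0 then z else 1) = _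
    rw [Fin.sum_univ_two]
    exact congrArg₂ (· + ·) (if_neg (by decide)) (if_pos (by decide))
  simp_rw [h]
  rw [← Fintype.piFinset_univ, ← prod_univ_sum (fun _ : Fin n => univ)
    (fun _ (a : ZMod 2) => if a ≠ 0 then z else 1), h2]
  simp

/-- The nontrivial additive character of `F₂`. -/
def signChar (a : ZMod 2) : ℝ := if a = 0 then 1 else -1

theorem signChar_add (a b : ZMod 2) : signChar (a + b) = signChar a * signChar b := by
  have h : ∀ a b : ZMod 2, a + b = 0 ↔ (a = 0 ↔ b = 0) := by decide
  by_cases ha : a = 0 <;> by_cases hb : b = 0 <;> simp [signChar, h, ha, hb]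

theorem signChar_zero : signChar 0 = 1 := by simp [signChar]

theorem signChar_one : signChar 1 = -1 := by simp [signChar]

theorem sum_signChar (u : Fin n → ZMod 2) :
    ∑ y, signChar (u ⬝ᵥ y) = if u = 0 then (2 : ℝ) ^ n else 0 := by
  split_ifs with h
  · simp [h, signChar_zero]
  · obtain ⟨i, hi⟩ := Function.ne_iff.1 h
    have hi : u i = 1 := (by decide : ∀ a : ZMod 2, a ≠ 0 → a = 1) _ hi
    have key := Equiv.sum_comp (Equiv.addRight (Pi.single i 1 : Fin n → ZMod 2))
      fun y => signChar (u ⬝ᵥ y)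
    simp only [Equiv.coe_addRight, dotProduct_add, signChar_add, dotProduct_single_one, hi,
      signChar_one, mul_neg, mul_one, sum_neg_distrib] at key
    linarith

/-- The Walsh–Fourier transform on the cube. -/
noncomputable def walsh (F : (Fin n → ZMod 2) → ℝ) (y : Fin n → ZMod 2) : ℝ :=
  ∑ x, F x * signChar (x ⬝ᵥ y)

theorem walsh_zero (F : (Fin n → ZMod 2) → ℝ) : walsh F 0 = ∑ x, F x := by
  simp [walsh, signChar_zero]

theorem walsh_add_right (F : (Fin n → ZMod 2) → ℝ) (a y : Fin n → ZMod 2) :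
    walsh (fun x => F (x + a)) y = signChar (a ⬝ᵥ y) * walsh F y := by
  rw [walsh, walsh, ← Equiv.sum_comp (Equiv.addRight a), mul_sum]
  refine sum_congr rfl fun x _ => ?_
  simp only [Equiv.coe_addRight, add_assoc, add_self_eq_zero_binary, add_zero, add_dotProduct,
    signChar_add]
  ring

theorem sum_walsh_mul_walsh (F G : (Fin n → ZMod 2) → ℝ) :
    ∑ y, walsh F y * walsh G y = 2 ^ n * ∑ x, F x * G x := by
  have h : ∀ x x' : Fin n → ZMod 2,
      ∑ y, F x * signChar (x ⬝ᵥ y) * (G x' * signChar (x' ⬝ᵥ y)) =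
        if x' = x then 2 ^ n * (F x * G x') else 0 := by
    intro x x'
    have h0 : x + x' = 0 ↔ x' = x := by
      constructor
      · intro h
        have := congrArg (x + ·) h
        simpa [← add_assoc, add_self_eq_zero_binary] using this
      · rintro rfl
        exact add_self_eq_zero_binary _
    calc _ = F x * G x' * ∑ y, signChar ((x + x') ⬝ᵥ y) := by
          rw [mul_sum]
          refine sum_congr rfl fun y _ => ?_
          rw [add_dotProduct, signChar_add]
          ring
      _ = _ := by
          rw [sum_signChar]
          simp only [h0]
          split_ifs <;> ring
  simp only [walsh, sum_mul_sum]
  rw [sum_comm, mul_sum]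
  refine sum_congr rfl fun x _ => ?_
  rw [sum_comm]
  simp [h]

/-- A function invariant under the dual code has its Walsh transform supported on the code. -/
theorem walsh_eq_zero_of_invariant (C : Submodule (ZMod 2) (Fin n → ZMod 2))
    (F : (Fin n → ZMod 2) → ℝ) (hF : ∀ x, ∀ c ∈ dualCode C, F (x + c) = F x)
    (y : Fin n → ZMod 2) (hy : y ∉ C) : walsh F y = 0 := by
  rw [← dualCode_dualCode C] at hy
  have : ∃ c ∈ dualCode C, y ⬝ᵥ c ≠ 0 := by
    by_contra! h
    exact hy h
  obtain ⟨c, hc, hyc⟩ := this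
  have h1 : c ⬝ᵥ y = 1 := by
    rw [dotProduct_comm]
    exact (by decide : ∀ a : ZMod 2, a ≠ 0 → a = 1) _ hyc
  have h2 := walsh_add_right F c y
  simp only [hF _ c hc, h1, signChar_one] at h2
  have : walsh F y = - walsh F y := by simpa using h2
  linarith

theorem sum_signChar_apply (y : Fin n → ZMod 2) :
    ∑ i, signChar (y i) = n - 2 * (hammingNorm y : ℝ) := by
  have h : ∀ a : ZMod 2, signChar a = 1 - 2 * (if a ≠ 0 then 1 else 0) := by
    intro a
    by_cases h : a = 0 <;> simp [signChar, h]
    norm_num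
  simp only [h, sum_sub_distrib, ← mul_sum, sum_boole, hammingNorm]
  simp

theorem sum_sum_mul_add_single (F : (Fin n → ZMod 2) → ℝ) :
    2 ^ n * ∑ x, F x * ∑ i, F (x + Pi.single i 1) =
      ∑ y, (n - 2 * (hammingNorm y : ℝ)) * walsh F y ^ 2 := by
  simp_rw [mul_sum (s := univ (α := Fin n))]
  rw [sum_comm, mul_sum]
  simp_rw [← sum_walsh_mul_walsh F, walsh_add_right, ← sum_signChar_apply, sum_mul]
  rw [sum_comm]
  refine sum_congr rfl fun y _ => sum_congr rfl fun i _ => ?_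
  rw [single_one_dotProduct]
  ring

/-- The spectral gap inequality for the coset graph of the dual of a code of large distance. -/
theorem spectral_bound (C : Submodule (ZMod 2) (Fin n → ZMod 2)) {δ l : ℝ}
    (hd : ∀ c ∈ C, c ≠ 0 → δ * n ≤ (hammingNorm c : ℝ))
    (F : (Fin n → ZMod 2) → ℝ) (hF0 : ∀ x, 0 ≤ F x)
    (hF : ∀ x, ∀ c ∈ dualCode C, F (x + c) = F x)
    (hl : ∀ x, l * F x ≤ ∑ i, F (x + Pi.single i 1)) :
    (l - (1 - 2 * δ) * n) * 2 ^ n * ∑ x, F x ^ 2 ≤ 2 * δ * n * (∑ x, F x) ^ 2 := by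
  have h1 : l * ∑ x, F x ^ 2 ≤ ∑ x, F x * ∑ i, F (x + Pi.single i 1) := by
    rw [mul_sum]
    refine sum_le_sum fun x _ => ?_
    nlinarith [mul_le_mul_of_nonneg_left (hl x) (hF0 x)]
  have h2 : ∑ y, (n - 2 * (hammingNorm y : ℝ)) * walsh F y ^ 2 ≤
      ∑ y, ((1 - 2 * δ) * n * walsh F y ^ 2 +
        if y = 0 then 2 * δ * n * walsh F y ^ 2 else 0) := by
    refine sum_le_sum fun y _ => ?_
    split_ifs with h
    · subst h; simp only [hammingNorm_zero, Nat.cast_zero]; linarith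
    · by_cases hy : y ∈ C
      · rw [add_zero]
        refine mul_le_mul_of_nonneg_right ?_ (sq_nonneg _)
        linarith [hd y hy h]
      · simp [walsh_eq_zero_of_invariant C F hF y hy]
  rw [← sum_sum_mul_add_single, sum_add_distrib, sum_ite_eq' univ, ← mul_sum] at h2
  have h3 := sum_walsh_mul_walsh F F
  simp only [← pow_two] at h3
  rw [h3, walsh_zero, if_pos (mem_univ _)] at h2
  have h4 := mul_le_mul_of_nonneg_left h1 (by positivity : (0 : ℝ) ≤ 2 ^ n)
  linarith

end BinaryCodes

section CosetLeaders

open Finset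

variable {n : ℕ}

/-- The weight of a coset leader of `x + D`. -/
noncomputable def cosetWeight (D : Submodule (ZMod 2) (Fin n → ZMod 2)) (x : Fin n → ZMod 2) : ℕ :=
  sInf {k | ∃ c ∈ D, hammingNorm (x + c) = k}

variable (D : Submodule (ZMod 2) (Fin n → ZMod 2))

theorem exists_hammingNorm_eq_cosetWeight (x : Fin n → ZMod 2) :
    ∃ c ∈ D, hammingNorm (x + c) = cosetWeight D x :=
  Nat.sInf_mem (s := {k | ∃ c ∈ D, hammingNorm (x + c) = k}) ⟨_, 0, D.zero_mem, rfl⟩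

variable {D}

theorem cosetWeight_le (x : Fin n → ZMod 2) {c : Fin n → ZMod 2} (hc : c ∈ D) :
    cosetWeight D x ≤ hammingNorm (x + c) :=
  Nat.sInf_le ⟨c, hc, rfl⟩

theorem cosetWeight_add_le (x : Fin n → ZMod 2) {c : Fin n → ZMod 2} (hc : c ∈ D) :
    cosetWeight D (x + c) ≤ cosetWeight D x := by
  obtain ⟨e, he, h⟩ := exists_hammingNorm_eq_cosetWeight D x
  rw [← h]
  refine (cosetWeight_le (x + c) (D.sub_mem he hc)).trans_eq ?_
  congr 1
  abel

theorem cosetWeight_add (x : Fin n → ZMod 2) {c : Fin n → ZMod 2} (hc : c ∈ D) :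
    cosetWeight D (x + c) = cosetWeight D x := by
  refine (cosetWeight_add_le x hc).antisymm ?_
  have := cosetWeight_add_le (x + c) hc
  rwa [add_assoc, add_self_eq_zero_binary, add_zero] at this

/-- A decreasing radial function on the cube which is `l`-subharmonic for the adjacency operator
stays so on the coset graph. -/
theorem le_sum_cosetWeight {φ : ℕ → ℝ} {l : ℝ} (hanti : Antitone φ)
    (hφ : ∀ k ≤ n, l * φ k ≤ k * φ (k - 1) + ((n : ℝ) - k) * φ (k + 1)) (x : Fin n → ZMod 2) :
    l * φ (cosetWeight D x) ≤ ∑ i, φ (cosetWeight D (x + Pi.single i 1)) := by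
  obtain ⟨c, hc, h⟩ := exists_hammingNorm_eq_cosetWeight D x
  set y := x + c with hy
  have hle : hammingNorm y ≤ n := by simpa using hammingNorm_le_card_fintype (x := y)
  rw [← h]
  refine (hφ _ hle).trans ?_
  have h1 : ∑ i, φ (hammingNorm (y + Pi.single i 1)) =
      hammingNorm y * φ (hammingNorm y - 1) + ((n : ℝ) - hammingNorm y) * φ (hammingNorm y + 1) := by
    simp only [hammingNorm_add_single, apply_ite φ]
    rw [sum_ite, sum_const, sum_const, nsmul_eq_mul, nsmul_eq_mul]
    have h2 := card_filter_add_card_filter_not (s := univ) (fun i : Fin n => y i ≠ 0)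
    rw [card_univ, Fintype.card_fin] at h2
    have h3 : ((#{i | ¬ y i ≠ 0} : ℕ) : ℝ) = n - hammingNorm y := by
      have h4 : hammingNorm y + #{i | ¬ y i ≠ 0} = n := h2
      rw [eq_sub_iff_add_eq, add_comm]
      exact_mod_cast h4
    rw [h3]
    rfl
  rw [← h1]
  refine sum_le_sum fun i _ => hanti ?_
  refine (cosetWeight_le _ hc).trans_eq ?_
  rw [hy]
  congr 1
  abel

theorem sum_pow_cosetWeight_mul_le [DecidablePred (· ∈ D)] {z : ℝ} (hz0 : 0 ≤ z) (hz1 : z ≤ 1) :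
    (∑ x, z ^ cosetWeight D x) * ∑ c : D, z ^ hammingNorm (c : Fin n → ZMod 2) ≤
      Nat.card D * (1 + z) ^ n := by
  have h1 : ∀ x, z ^ cosetWeight D x * ∑ c : D, z ^ hammingNorm (c : Fin n → ZMod 2) ≤
      ∑ c : D, z ^ hammingNorm (x + (c : Fin n → ZMod 2)) := by
    intro x
    obtain ⟨e, he, h⟩ := exists_hammingNorm_eq_cosetWeight D x
    rw [mul_sum, ← Equiv.sum_comp (Equiv.addLeft (⟨e, he⟩ : D))
      fun c => z ^ hammingNorm (x + (c : Fin n → ZMod 2))]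
    refine sum_le_sum fun c _ => ?_
    rw [← pow_add, ← h]
    refine pow_le_pow_of_le_one hz0 hz1 ?_
    simpa [add_assoc] using hammingNorm_add_le (x + e) c
  rw [sum_mul]
  refine (sum_le_sum fun x _ => h1 x).trans_eq ?_
  rw [sum_comm, Nat.card_eq_fintype_card, ← card_univ, ← nsmul_eq_mul, ← sum_const]
  refine sum_congr rfl fun c _ => ?_
  rw [← sum_pow_hammingNorm]
  exact Equiv.sum_comp (Equiv.addRight (c : Fin n → ZMod 2)) fun x => z ^ hammingNorm x

theorem one_add_pow_card_le_sum_powerset {w : ℕ} {z : ℝ} (hz0 : 0 ≤ z) (hz1 : z ≤ 1)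
    (T : Finset (Fin n → ZMod 2)) (hT : ∀ t ∈ T, hammingNorm t ≤ w) :
    (1 + z ^ w) ^ #T ≤ ∑ U ∈ T.powerset, z ^ hammingNorm (∑ t ∈ U, t) := by
  induction T using Finset.induction_on with
  | empty => simp
  | insert v T hv ih =>
    have ih := ih fun t ht => hT t (mem_insert_of_mem ht)
    rw [card_insert_of_notMem hv, pow_succ, sum_powerset_insert hv, mul_add, mul_one]
    refine add_le_add ih ?_
    refine (mul_le_mul_of_nonneg_right ih (by positivity)).trans ?_
    rw [sum_mul]
    refine sum_le_sum fun U hU => ?_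
    rw [sum_insert fun h => hv (mem_powerset.1 hU h), ← pow_add]
    refine pow_le_pow_of_le_one hz0 hz1 ((hammingNorm_add_le _ _).trans ?_)
    have := hT v (mem_insert_self _ _)
    omega

theorem exists_minimal_cover {S : Finset (Fin n → ZMod 2)} (hS : ∀ i, ∃ s ∈ S, s i ≠ 0) :
    ∃ T ⊆ S, (∀ i, ∃ t ∈ T, t i ≠ 0) ∧ ∀ t ∈ T, ∃ i, t i ≠ 0 ∧ ∀ s ∈ T, s ≠ t → s i = 0 := by
  induction S using Finset.strongInduction with
  | H S ih =>
    by_cases h : ∃ t ∈ S, ∀ i, t i ≠ 0 → ∃ s ∈ S, s ≠ t ∧ s i ≠ 0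
    · obtain ⟨t, ht, h⟩ := h
      have hcov : ∀ i, ∃ s ∈ S.erase t, s i ≠ 0 := by
        intro i
        obtain ⟨s, hs, hsi⟩ := hS i
        by_cases hst : s = t
        · obtain ⟨s', h1, h2, h3⟩ := h i (hst ▸ hsi)
          exact ⟨s', mem_erase.2 ⟨h2, h1⟩, h3⟩
        · exact ⟨s, mem_erase.2 ⟨hst, hs⟩, hsi⟩
      obtain ⟨T, hT, h'⟩ := ih _ (erase_ssubset ht) hcov
      exact ⟨T, hT.trans (erase_subset _ _), h'⟩
    · push Not at h
      exact ⟨S, Subset.rfl, hS, h⟩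

theorem exists_one_add_pow_le_weightEnumerator [DecidablePred (· ∈ D)] {w : ℕ} {z : ℝ}
    (hz0 : 0 ≤ z) (hz1 : z ≤ 1)
    (hD : ∀ i, ∃ s ∈ D, hammingNorm s ≤ w ∧ s i ≠ 0) :
    ∃ m : ℕ, n ≤ m * w ∧ (1 + z ^ w) ^ m ≤ ∑ c : D, z ^ hammingNorm (c : Fin n → ZMod 2) := by
  classical
  obtain ⟨T, hTS, hcov, hpriv⟩ := exists_minimal_cover
    (S := univ.filter fun s => s ∈ D ∧ hammingNorm s ≤ w) fun i => by
      obtain ⟨s, h1, h2, h3⟩ := hD i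
      exact ⟨s, by simp [h1, h2], h3⟩
  have hT : ∀ t ∈ T, t ∈ D ∧ hammingNorm t ≤ w := fun t ht => by simpa using hTS ht
  refine ⟨#T, ?_, ?_⟩
  · calc n = #(univ : Finset (Fin n)) := by simp
      _ ≤ #(T.biUnion fun t => univ.filter fun i => t i ≠ 0) := by
          refine card_le_card fun i _ => ?_
          obtain ⟨t, ht, hi⟩ := hcov i
          exact mem_biUnion.2 ⟨t, ht, by simpa using hi⟩
      _ ≤ #T * w := card_biUnion_le_card_mul _ _ _ fun t ht => (hT t ht).2
  · refine (one_add_pow_card_le_sum_powerset hz0 hz1 T fun t ht => (hT t ht).2).trans ?_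
    have hinj : Set.InjOn (fun U : Finset (Fin n → ZMod 2) => ∑ t ∈ U, t) T.powerset := by
      have key : ∀ t ∈ T, ∃ i, ∀ U ⊆ T, t ∈ U ↔ (∑ s ∈ U, s) i ≠ 0 := by
        intro t ht
        obtain ⟨i, hti, hi⟩ := hpriv t ht
        refine ⟨i, fun U hU => ?_⟩
        rw [Finset.sum_apply]
        by_cases htU : t ∈ U
        · rw [sum_eq_single_of_mem t htU fun s hs hst => hi s (hU hs) hst]
          simp [htU, hti]
        · rw [sum_eq_zero fun s hs => hi s (hU hs) fun h => htU (h ▸ hs)]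
          simp [htU]
      intro U hU U' hU' h
      rw [mem_coe, mem_powerset] at hU hU'
      have h : ∑ s ∈ U, s = ∑ s ∈ U', s := h
      ext t
      by_cases ht : t ∈ T
      · obtain ⟨i, hi⟩ := key t ht
        rw [hi U hU, hi U' hU', h]
      · exact iff_of_false (fun h => ht (hU h)) fun h => ht (hU' h)
    rw [← sum_image (f := fun c => z ^ hammingNorm c) hinj,
      ← sum_subtype (univ.filter fun c => c ∈ D) (fun c => by simp) fun c => z ^ hammingNorm c]
    refine sum_le_sum_of_subset_of_nonneg (fun c hc => ?_) fun _ _ _ => by positivity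
    obtain ⟨U, hU, rfl⟩ := mem_image.1 hc
    rw [mem_powerset] at hU
    simpa using D.sum_mem fun t ht => (hT t (hU ht)).1

end CosetLeaders

section CardBound

open Finset

variable {n : ℕ}

theorem exists_mem_dualCode_apply_ne_zero {C : Submodule (ZMod 2) (Fin n → ZMod 2)} {δ : ℝ}
    (hδn : 1 < δ * n) (hd : ∀ c ∈ C, c ≠ 0 → δ * n ≤ (hammingNorm c : ℝ))
    {S : Set (Fin n → ZMod 2)} (hS : Submodule.span (ZMod 2) S = dualCode C) (i : Fin n) :
    ∃ s ∈ S, s i ≠ 0 := by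
  by_contra! h
  have hD : ∀ x ∈ dualCode C, x i = 0 := by
    intro x hx
    rw [← hS] at hx
    have hle : Submodule.span (ZMod 2) S ≤ LinearMap.ker (LinearMap.proj (R := ZMod 2) i) :=
      Submodule.span_le.2 fun s hs => h s hs
    exact hle hx
  have hmem : (Pi.single i 1 : Fin n → ZMod 2) ∈ C := by
    rw [← dualCode_dualCode C]
    intro x hx
    exact (single_one_dotProduct i x).trans (hD x hx)
  have hne : (Pi.single i 1 : Fin n → ZMod 2) ≠ 0 := by simp
  have h1 : hammingNorm (Pi.single i 1 : Fin n → ZMod 2) = 1 := by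
    simpa using hammingNorm_add_single 0 i
  have := hd _ hmem hne
  rw [h1, Nat.cast_one] at this
  linarith

theorem card_code_le (C : Submodule (ZMod 2) (Fin n → ZMod 2)) {w r : ℕ} {δ l z : ℝ}
    {φ : ℕ → ℝ} (hδn : 1 < δ * n)
    (hspan : ∃ S : Set (Fin n → ZMod 2), (∀ x ∈ S, hammingNorm x ≤ w) ∧
      Submodule.span (ZMod 2) S = dualCode C)
    (hd : ∀ c ∈ C, c ≠ 0 → δ * n ≤ (hammingNorm c : ℝ))
    (hz0 : 0 < z) (hz1 : z ≤ 1) (hl : (1 - 2 * δ) * n ≤ l)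
    (hanti : Antitone φ) (hφ0 : 0 < φ 0) (hφnonneg : ∀ k, 0 ≤ φ k) (hφr : ∀ k, r < k → φ k = 0)
    (hφ : ∀ k ≤ n, l * φ k ≤ k * φ (k - 1) + ((n : ℝ) - k) * φ (k + 1)) :
    ∃ m : ℕ, n ≤ m * w ∧
      (l - (1 - 2 * δ) * n) * z ^ r * (1 + z ^ w) ^ m * Nat.card C ≤ 2 * δ * n * (1 + z) ^ n := by
  classical
  obtain ⟨S, hSw, hS⟩ := hspan
  set D := dualCode C with hDdef
  obtain ⟨m, hm, hW⟩ := exists_one_add_pow_le_weightEnumerator (D := D) (w := w) hz0.le hz1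
    fun i => by
      obtain ⟨s, hs, hi⟩ := exists_mem_dualCode_apply_ne_zero hδn hd hS i
      exact ⟨s, hS ▸ Submodule.subset_span hs, hSw s hs, hi⟩
  refine ⟨m, hm, ?_⟩
  set F : (Fin n → ZMod 2) → ℝ := fun x => φ (cosetWeight D x) with hF
  have hspec := spectral_bound C hd F (fun x => hφnonneg _)
    (fun x c hc => congrArg φ (cosetWeight_add x hc)) (le_sum_cosetWeight hanti hφ)
  have hN : 0 < ∑ x, F x ^ 2 := by
    have h0 : cosetWeight D 0 = 0 := by
      simpa using cosetWeight_le (0 : Fin n → ZMod 2) D.zero_mem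
    refine sum_pos' (fun _ _ => sq_nonneg _) ⟨0, mem_univ _, ?_⟩
    simp only [hF, h0]
    positivity
  have hCS : z ^ r * (∑ x, F x) ^ 2 ≤ (∑ x, F x ^ 2) * ∑ x, z ^ cosetWeight D x := by
    have h := sum_sq_le_sum_mul_sum_of_sq_le_mul univ (r := F)
      (f := fun x => F x ^ 2 / z ^ cosetWeight D x) (g := fun x => z ^ cosetWeight D x)
      (fun _ _ => by positivity) (fun _ _ => by positivity)
      (fun x _ => by field_simp; rfl)
    refine (mul_le_mul_of_nonneg_left h (by positivity)).trans ?_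
    rw [← mul_assoc, mul_sum univ (fun x => F x ^ 2 / z ^ cosetWeight D x)]
    refine mul_le_mul_of_nonneg_right (sum_le_sum fun x _ => ?_)
      (sum_nonneg fun _ _ => by positivity)
    by_cases hx : r < cosetWeight D x
    · simp [hF, hφr _ hx]
    · have := pow_le_pow_of_le_one hz0.le hz1 (not_lt.1 hx)
      rw [mul_div_assoc', div_le_iff₀ (by positivity), mul_comm]
      exact mul_le_mul_of_nonneg_left this (sq_nonneg _)
  have hP := sum_pow_cosetWeight_mul_le (D := D) hz0.le hz1
  have hcard : (Nat.card C : ℝ) * Nat.card D = 2 ^ n := by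
    exact_mod_cast card_mul_card_dualCode C
  set N := ∑ x, F x ^ 2
  set P := ∑ x, z ^ cosetWeight D x
  set W := ∑ c : D, z ^ hammingNorm (c : Fin n → ZMod 2)
  set g := l - (1 - 2 * δ) * n
  have hg : 0 ≤ g := sub_nonneg.2 hl
  have hW0 : 0 ≤ W := le_trans (by positivity) hW
  have hDpos : 0 < (Nat.card D : ℝ) := by exact_mod_cast Nat.card_pos
  have h1 : g * 2 ^ n * z ^ r ≤ 2 * δ * n * P := by
    refine le_of_mul_le_mul_right ?_ hN
    have h2 := mul_le_mul_of_nonneg_right hspec (by positivity : 0 ≤ z ^ r)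
    have h3 := mul_le_mul_of_nonneg_left hCS (by linarith : 0 ≤ 2 * δ * n)
    linarith
  refine le_of_mul_le_mul_right ?_ hDpos
  calc g * z ^ r * (1 + z ^ w) ^ m * Nat.card C * Nat.card D
      = g * 2 ^ n * z ^ r * (1 + z ^ w) ^ m := by rw [← hcard]; ring
    _ ≤ g * 2 ^ n * z ^ r * W := by gcongr
    _ ≤ 2 * δ * n * P * W := by gcongr
    _ = 2 * δ * n * (P * W) := by ring
    _ ≤ 2 * δ * n * (Nat.card D * (1 + z) ^ n) :=
        mul_le_mul_of_nonneg_left hP (by linarith)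
    _ = _ := by ring

/-- A decreasing profile: constant up to `a`, then decaying like a Gaussian, and cut off
after `a + L`. -/
noncomputable def gaussProfile (p : ℝ) (a L k : ℕ) : ℝ :=
  if k ≤ a + L then p ^ ((k - a) * (k - a + 1)) else 0

variable {p : ℝ} {a L : ℕ}

theorem gaussProfile_nonneg (hp : 0 ≤ p) (k : ℕ) : 0 ≤ gaussProfile p a L k := by
  unfold gaussProfile
  split_ifs <;> positivity

theorem gaussProfile_eq_one {k : ℕ} (hk : k ≤ a) : gaussProfile p a L k = 1 := by
  rw [gaussProfile, if_pos (by omega), Nat.sub_eq_zero_of_le hk, zero_mul, pow_zero]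

theorem gaussProfile_antitone (hp0 : 0 ≤ p) (hp1 : p ≤ 1) : Antitone (gaussProfile p a L) := by
  intro k k' hk
  by_cases h : k' ≤ a + L
  · rw [gaussProfile, gaussProfile, if_pos h, if_pos (hk.trans h)]
    have : k - a ≤ k' - a := Nat.sub_le_sub_right hk a
    exact pow_le_pow_of_le_one hp0 hp1 (Nat.mul_le_mul this (by omega))
  · rw [gaussProfile, if_neg h]
    exact gaussProfile_nonneg hp0 k

theorem gaussProfile_subharmonic {μ ρ : ℝ} (hp0 : 0 < p) (hμ1 : μ ≤ 1)
    (hμ : μ ^ 2 ≤ 4 * (ρ * (1 - ρ)) * p ^ 2)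
    (hL : p ^ (2 * L) ≤ ρ) (ha0 : 0 < a) (ha : ρ * n ≤ a) (haL : 2 * (a + L) ≤ n)
    (k : ℕ) (hk : k ≤ n) :
    μ * n * gaussProfile p a L k ≤ k * gaussProfile p a L (k - 1) +
      ((n : ℝ) - k) * gaussProfile p a L (k + 1) := by
  have hkn : (k : ℝ) ≤ n := by exact_mod_cast hk
  have hn0 : (0 : ℝ) ≤ n := by positivity
  rcases lt_or_ge k a with h | h
  · rw [gaussProfile_eq_one h.le, gaussProfile_eq_one (by omega), gaussProfile_eq_one (by omega)]
    nlinarith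
  obtain ⟨j, rfl⟩ := Nat.exists_eq_add_of_le h
  rcases lt_or_ge (a + L) (a + j) with h' | h'
  · rw [gaussProfile, if_neg (by omega), mul_zero]
    exact add_nonneg (mul_nonneg (by positivity) (gaussProfile_nonneg hp0.le _))
      (mul_nonneg (by linarith) (gaussProfile_nonneg hp0.le _))
  set f := gaussProfile p a L (a + j) with hf
  have hf0 : 0 < f := by
    rw [hf, gaussProfile, if_pos h']
    positivity
  have hprev : gaussProfile p a L (a + j - 1) = f / p ^ (2 * j) := by
    rw [eq_div_iff (by positivity), hf, gaussProfile, gaussProfile, if_pos (by omega), if_pos h',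
      ← pow_add]
    congr 1
    rcases j with _ | j
    · simp
    · rw [show a + (j + 1) - 1 - a = j by omega, show a + (j + 1) - a = j + 1 by omega]
      ring
  rcases eq_or_lt_of_le h' with h'' | h''
  · have hj : j = L := by omega
    have hnext : gaussProfile p a L (a + j + 1) = 0 := by rw [gaussProfile, if_neg (by omega)]
    rw [hnext, hprev, mul_zero, add_zero, mul_div_assoc', le_div_iff₀ (by positivity), hj]
    have h1 : ρ * n ≤ ((a + L : ℕ) : ℝ) := by
      push_cast
      linarith [(Nat.cast_nonneg L : (0 : ℝ) ≤ L)]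
    calc μ * n * f * p ^ (2 * L) = f * (μ * p ^ (2 * L) * n) := by ring
      _ ≤ f * (1 * ρ * n) := by gcongr
      _ ≤ f * ((a + L : ℕ) : ℝ) := by gcongr; linarith
      _ = _ := mul_comm _ _
  · have hnext : gaussProfile p a L (a + j + 1) = f * (p ^ (2 * j) * p ^ 2) := by
      rw [hf, gaussProfile, gaussProfile, if_pos (by omega), if_pos h', ← pow_add, ← pow_add]
      congr 1
      rw [show a + j + 1 - a = j + 1 by omega, show a + j - a = j by omega]
      ring
    rw [hprev, hnext]
    set k : ℝ := ((a + j : ℕ) : ℝ) with hkdef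
    have hk1 : ρ * n ≤ k := by
      rw [hkdef]; push_cast; linarith [(Nat.cast_nonneg j : (0 : ℝ) ≤ j)]
    have hk2 : 2 * k ≤ n := by
      rw [hkdef]
      exact_mod_cast (by omega : 2 * (a + j) ≤ n)
    have hk0 : 0 < k := by rw [hkdef]; exact_mod_cast (by omega : 0 < a + j)
    set s := p ^ (2 * j)
    have hs : 0 < s := by positivity
    have key : μ * n ≤ k / s + (n - k) * (s * p ^ 2) := by
      refine le_of_sq_le_sq ?_ (add_nonneg (by positivity)
        (mul_nonneg (by linarith) (by positivity)))
      have h1 : ρ * (1 - ρ) * (n : ℝ) ^ 2 ≤ k * (n - k) := by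
        nlinarith [mul_nonneg (sub_nonneg.2 hk1) (by nlinarith : 0 ≤ n - k - ρ * n)]
      have h2 : 4 * (k / s * ((n - k) * (s * p ^ 2))) = 4 * (k * (n - k)) * p ^ 2 := by
        field_simp
      have h3 := sq_nonneg (k / s - (n - k) * (s * p ^ 2))
      have h4 : (μ * n) ^ 2 ≤ 4 * (k * (n - k)) * p ^ 2 := by
        calc (μ * n) ^ 2 = μ ^ 2 * (n : ℝ) ^ 2 := by ring
          _ ≤ 4 * (ρ * (1 - ρ)) * p ^ 2 * (n : ℝ) ^ 2 := by gcongr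
          _ = 4 * (ρ * (1 - ρ) * (n : ℝ) ^ 2) * p ^ 2 := by ring
          _ ≤ _ := by gcongr
      nlinarith
    calc μ * n * f ≤ (k / s + (n - k) * (s * p ^ 2)) * f := by gcongr
      _ = _ := by ring

end CardBound

section Asymptotics

open Filter

theorem span_single_eq_dualCode_bot (n : ℕ) :
    Submodule.span (ZMod 2) (Set.range fun i : Fin n => (Pi.single i 1 : Fin n → ZMod 2)) =
      dualCode ⊥ := by
  have h1 : dualCode (⊥ : Submodule (ZMod 2) (Fin n → ZMod 2)) = ⊤ := by
    refine eq_top_iff.2 fun x _ c hc => ?_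
    simp [(Submodule.mem_bot _).1 hc]
  rw [h1, ← (Pi.basisFun (ZMod 2) (Fin n)).span_eq]
  congr 2
  ext1 i
  rw [Pi.basisFun_apply]

/-- The maximum defining `maxLDPCCard` is attained. -/
theorem exists_code_card_eq_maxLDPCCard {w : ℕ} (hw : 1 ≤ w) (n : ℕ) (δ : ℝ) :
    ∃ C : Submodule (ZMod 2) (Fin n → ZMod 2),
      (∃ S : Set (Fin n → ZMod 2), (∀ x ∈ S, hammingNorm x ≤ w) ∧
        Submodule.span (ZMod 2) S = dualCode C) ∧
      (∀ c ∈ C, c ≠ 0 → δ * n ≤ (hammingNorm c : ℝ)) ∧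
      Nat.card C = maxLDPCCard w n δ := by
  refine Nat.sSup_mem (s := {k | ∃ C : Submodule (ZMod 2) (Fin n → ZMod 2),
    (∃ S : Set (Fin n → ZMod 2), (∀ x ∈ S, hammingNorm x ≤ w) ∧
      Submodule.span (ZMod 2) S = dualCode C) ∧
    (∀ c ∈ C, c ≠ 0 → δ * n ≤ (hammingNorm c : ℝ)) ∧ Nat.card C = k}) ?_ ?_
  · refine ⟨_, ⊥, ⟨_, ?_, span_single_eq_dualCode_bot n⟩,
      fun c hc h => absurd ((Submodule.mem_bot _).1 hc) h, rfl⟩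
    rintro _ ⟨i, rfl⟩
    simpa using (hammingNorm_add_single 0 i).trans_le (by simpa using hw)
  · refine ⟨Nat.card (Fin n → ZMod 2), ?_⟩
    rintro _ ⟨C, -, -, rfl⟩
    exact Nat.card_le_card_of_injective _ Subtype.val_injective

theorem eventually_logb_maxLDPCCard_le {w : ℕ} (hw : 1 ≤ w) {δ ρ z : ℝ} (hδ0 : 0 < δ)
    (hδ2 : δ < 1 / 2) (hρ0 : 0 < ρ) (hρ2 : ρ < 1 / 2)
    (hδρ : (1 - 2 * δ) ^ 2 < 4 * (ρ * (1 - ρ))) (hz0 : 0 < z) (hz1 : z ≤ 1) :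
    ∃ K : ℝ, ∀ᶠ n : ℕ in atTop, Real.logb 2 (maxLDPCCard w n δ) ≤
      n * (-ρ * Real.logb 2 z + Real.logb 2 (1 + z) - 1 / w * Real.logb 2 (1 + z ^ w)) + K := by
  have hσ0 : 0 < 4 * (ρ * (1 - ρ)) := by nlinarith
  set σ := √(4 * (ρ * (1 - ρ))) with hσ
  have hσpos : 0 < σ := Real.sqrt_pos.2 hσ0
  have hσsq : σ ^ 2 = 4 * (ρ * (1 - ρ)) := Real.sq_sqrt hσ0.le
  have hσδ : 1 - 2 * δ < σ := Real.lt_sqrt_of_sq_lt hδρ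
  have hσ1 : σ ≤ 1 := Real.sqrt_le_one.2 (by nlinarith [sq_nonneg (1 - 2 * ρ)])
  obtain ⟨μ, hδμ, hμσ⟩ := exists_between hσδ
  have hμ0 : 0 < μ := by linarith
  set p := μ / σ with hp
  have hp0 : 0 < p := div_pos hμ0 hσpos
  have hp1 : p < 1 := (div_lt_one hσpos).2 hμσ
  have hμp : μ ^ 2 ≤ 4 * (ρ * (1 - ρ)) * p ^ 2 := by
    rw [← hσsq, ← mul_pow, hp, mul_div_cancel₀ _ hσpos.ne']
  obtain ⟨L, hL⟩ := exists_pow_lt_of_lt_one hρ0 (pow_lt_one₀ hp0.le hp1 two_ne_zero)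
  rw [← pow_mul] at hL
  set η := μ - (1 - 2 * δ) with hη
  have hη0 : 0 < η := sub_pos.2 hδμ
  have hlogz : Real.logb 2 z ≤ 0 := Real.logb_nonpos one_lt_two hz0.le hz1
  refine ⟨Real.logb 2 (2 * δ) - Real.logb 2 η - (1 + L) * Real.logb 2 z, ?_⟩
  have hlim1 : ∀ᶠ n : ℕ in atTop, 1 < δ * n :=
    (tendsto_natCast_atTop_atTop.const_mul_atTop hδ0).eventually_gt_atTop 1
  have hlim2 : ∀ᶠ n : ℕ in atTop, 2 + 2 * (L : ℝ) ≤ (1 - 2 * ρ) * n :=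
    (tendsto_natCast_atTop_atTop.const_mul_atTop (by linarith)).eventually_ge_atTop _
  filter_upwards [hlim1, hlim2, eventually_gt_atTop 0] with n hn1 hn2 hn0
  have hn0' : (0 : ℝ) < n := by exact_mod_cast hn0
  have ha0 : 0 < ⌈ρ * n⌉₊ := Nat.ceil_pos.2 (by positivity)
  have ha1 : ρ * n ≤ ⌈ρ * n⌉₊ := Nat.le_ceil _
  have ha2 : (⌈ρ * n⌉₊ : ℝ) < ρ * n + 1 := Nat.ceil_lt_add_one (by positivity)
  set a := ⌈ρ * n⌉₊
  have haL : 2 * (a + L) ≤ n := by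
    have : (2 * (a + L) : ℝ) ≤ n := by linarith
    exact_mod_cast this
  obtain ⟨C, hspan, hd, hcard⟩ := exists_code_card_eq_maxLDPCCard hw n δ
  obtain ⟨m, hm, hC⟩ := card_code_le C (r := a + L) (l := μ * n) (φ := gaussProfile p a L)
    hn1 hspan hd hz0 hz1 (by gcongr) (gaussProfile_antitone hp0.le hp1.le)
    (by simp [gaussProfile_eq_one]) (gaussProfile_nonneg hp0.le)
    (fun k hk => if_neg (not_le.2 hk))
    (gaussProfile_subharmonic hp0 (hμσ.le.trans hσ1) hμp hL.le ha0 ha1 haL)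
  rw [← hcard]
  have hM : (0 : ℝ) < Nat.card C := by exact_mod_cast Nat.card_pos
  set M : ℝ := (Nat.card C : ℝ)
  have hC' : η * z ^ (a + L) * (1 + z ^ w) ^ m * M ≤ 2 * δ * (1 + z) ^ n := by
    refine le_of_mul_le_mul_right ?_ hn0'
    rw [hη]
    linarith
  have hlog := Real.logb_le_logb_of_le one_lt_two (by positivity) hC'
  rw [Real.logb_mul (by positivity) hM.ne', Real.logb_mul (by positivity) (by positivity),
    Real.logb_mul hη0.ne' (by positivity), Real.logb_mul (by positivity) (by positivity),
    Real.logb_pow, Real.logb_pow, Real.logb_pow] at hlog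
  have hr : (ρ * n + 1 + L) * Real.logb 2 z ≤ ((a + L : ℕ) : ℝ) * Real.logb 2 z := by
    refine mul_le_mul_of_nonpos_right ?_ hlogz
    push_cast
    linarith
  have hmw : n * (1 / w * Real.logb 2 (1 + z ^ w)) ≤ m * Real.logb 2 (1 + z ^ w) := by
    rw [← mul_assoc]
    refine mul_le_mul_of_nonneg_right ?_ (Real.logb_nonneg one_lt_two (by simp; positivity))
    rw [mul_one_div, div_le_iff₀ (by exact_mod_cast hw)]
    exact_mod_cast hm
  linarith

theorem LDPCRate_le_of_eventually_le {w : ℕ} {δ X K : ℝ}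
    (h : ∀ᶠ n : ℕ in atTop, Real.logb 2 (maxLDPCCard w n δ) ≤ n * X + K) :
    LDPCRate w δ ≤ X := by
  have hcob : IsCoboundedUnder (· ≤ ·) atTop
      fun n : ℕ => Real.logb 2 (maxLDPCCard w n δ) / n := by
    refine IsBoundedUnder.isCoboundedUnder_le ⟨0, ?_⟩
    refine eventually_map.2 (Eventually.of_forall fun n => ?_)
    refine div_nonneg ?_ n.cast_nonneg
    rcases Nat.eq_zero_or_pos (maxLDPCCard w n δ) with h0 | h0
    · simp [h0]
    · exact Real.logb_nonneg one_lt_two (by exact_mod_cast h0)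
  refine le_of_forall_pos_le_add fun ε hε => limsup_le_of_le hcob ?_
  have hK : ∀ᶠ n : ℕ in atTop, K ≤ ε * n :=
    (tendsto_natCast_atTop_atTop.const_mul_atTop hε).eventually_ge_atTop _
  filter_upwards [h, hK, eventually_gt_atTop 0] with n h1 h2 h3
  rw [div_le_iff₀ (by exact_mod_cast h3)]
  linarith

end Asymptotics

/-- for `w ≥ 3`, `δ ∈ (0,1/2)` and `ρ = 1/2 − √(δ(1−δ))`,
`R_w(δ) ≤ H(ρ) − (1/w) log₂(1 + (ρ/(1−ρ))^w)`. -/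
theorem LDPCRate_le_general (w : ℕ) (hw : 3 ≤ w)
    (δ : ℝ) (hδ0 : 0 < δ) (hδ2 : δ < 1 / 2)
    (ρ : ℝ) (hρ : ρ = 1 / 2 - Real.sqrt (δ * (1 - δ))) :
    LDPCRate w δ ≤ binEnt ρ - (1 / (w : ℝ)) * Real.logb 2 (1 + (ρ / (1 - ρ)) ^ w) := by
  have hδ : 0 < δ * (1 - δ) := by nlinarith
  have hs := Real.sq_sqrt hδ.le
  have hspos := Real.sqrt_pos.2 hδ
  have hρ2 : ρ < 1 / 2 := by linarith
  have hρδ : (1 - 2 * δ) ^ 2 = 4 * (ρ * (1 - ρ)) := by rw [hρ]; nlinarith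
  have hρ0 : 0 < ρ := by
    have : 0 < (1 - 2 * δ) ^ 2 := pow_pos (by linarith) 2
    nlinarith
  set z := ρ / (1 - ρ) with hz
  have hz0 : 0 < z := div_pos hρ0 (by linarith)
  have hz1 : z ≤ 1 := (div_le_one (by linarith)).2 (by linarith)
  have hbin : binEnt ρ = -ρ * Real.logb 2 z + Real.logb 2 (1 + z) := by
    have h1 : 1 + z = (1 - ρ)⁻¹ := by
      rw [hz]
      field_simp [(by linarith : 1 - ρ ≠ 0)]
      ring
    rw [h1, Real.logb_inv, hz, Real.logb_div hρ0.ne' (by linarith), binEnt]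
    ring
  rw [hbin]
  have hη : ∀ ρ' ∈ Set.Ioo ρ (1 / 2), LDPCRate w δ ≤
      -ρ' * Real.logb 2 z + Real.logb 2 (1 + z) - 1 / w * Real.logb 2 (1 + z ^ w) := by
    intro ρ' hρ'
    obtain ⟨K, hK⟩ := eventually_logb_maxLDPCCard_le (by omega : 1 ≤ w) hδ0 hδ2
      (hρ0.trans hρ'.1) hρ'.2 (by nlinarith [hρ'.1, hρ'.2]) hz0 hz1
    exact LDPCRate_le_of_eventually_le hK
  have hcont : Continuous fun ρ' : ℝ =>
      -ρ' * Real.logb 2 z + Real.logb 2 (1 + z) - 1 / w * Real.logb 2 (1 + z ^ w) := by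
    fun_prop
  refine ge_of_tendsto (hcont.continuousWithinAt (s := Set.Ioi ρ) (x := ρ)) ?_
  filter_upwards [Ioo_mem_nhdsGT hρ2] with ρ' hρ' using hη ρ' hρ'
end

section
/- Let δ ∈ (0,1/2) and set ρ = 1/2 − √(δ(1−δ)). If δ ≤ 1/2 − √3/4 then R₃(δ) ≤ 2/3, and if δ > 1/2 − √3/4 then R₃(δ) ≤ (2/3) H₄(3ρ), where H₄(x) = x log₄ 3 − x log₄ x − (1−x) log₄ (1−x). -/
/-- `H₄(x) = x log₄ 3 − x log₄ x − (1−x) log₄ (1−x)`. -/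
noncomputable def quadEnt (x : ℝ) : ℝ :=
  x * Real.logb 4 3 - x * Real.logb 4 x - (1 - x) * Real.logb 4 (1 - x)

/-- `φ` dominates `z ^ |g|` for the word length `|g|` in the generators `g i`, `i ∈ U`, and has
total mass at most `(1 + 3 z) ^ (|U| / 3)`. -/
structure IsLengthWeight {ι G : Type*} [AddCommGroup G] [Fintype G] (g : ι → G) (z : ℝ)
    (U : Finset ι) (φ : G → ℝ) : Prop where
  nonneg : ∀ h, 0 ≤ φ h
  one_le : 1 ≤ φ 0
  mul_le : ∀ j ∈ U, ∀ h, z * φ h ≤ φ (h + g j)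
  sum_cube_le : (∑ h, φ h) ^ 3 ≤ (1 + 3 * z) ^ U.card

namespace IsLengthWeight

variable {ι G : Type*} [AddCommGroup G] [Fintype G] {g : ι → G} {z : ℝ}
  {U : Finset ι} {φ : G → ℝ}

theorem sum_translate (φ : G → ℝ) (v : G) : ∑ h, φ (h + v) = ∑ h, φ h :=
  Equiv.sum_comp (Equiv.addRight v) φ

theorem pow_card_le [DecidableEq ι] (hφ : IsLengthWeight g z U φ) (hz : 0 ≤ z)
    (S : Finset ι) (hS : S ⊆ U) :
    z ^ S.card ≤ φ (∑ i ∈ S, g i) := by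
  induction S using Finset.induction_on with
  | empty => simpa using hφ.one_le
  | insert a s ha ih =>
    rw [Finset.sum_insert ha, Finset.card_insert_of_notMem ha, pow_succ', add_comm (g a)]
    exact (mul_le_mul_of_nonneg_left (ih fun x hx => hS (Finset.mem_insert_of_mem hx)) hz).trans
      (hφ.mul_le a (hS (Finset.mem_insert_self _ _)) _)

theorem sum_nonneg (hφ : IsLengthWeight g z U φ) : 0 ≤ ∑ h, φ h :=
  Finset.sum_nonneg fun h _ => hφ.nonneg h

/-- Bookkeeping for the total mass when `U` is enlarged. -/
theorem cube_le_of_factor (hφ : IsLengthWeight g z U φ) (hz : 0 ≤ z) {φ' : G → ℝ}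
    (hφ' : ∀ h, 0 ≤ φ' h) {c : ℝ} {k m : ℕ} (hs : ∑ h, φ' h ≤ c * ∑ h, φ h)
    (hc : c ^ 3 ≤ (1 + 3 * z) ^ k) (hm : m = U.card + k) :
    (∑ h, φ' h) ^ 3 ≤ (1 + 3 * z) ^ m := by
  have h0 : 0 ≤ ∑ h, φ' h := Finset.sum_nonneg fun h _ => hφ' h
  calc (∑ h, φ' h) ^ 3 ≤ (c * ∑ h, φ h) ^ 3 := by gcongr
    _ = c ^ 3 * (∑ h, φ h) ^ 3 := mul_pow ..
    _ ≤ (1 + 3 * z) ^ k * (1 + 3 * z) ^ U.card := by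
        have := hφ.sum_nonneg
        have := hφ.sum_cube_le
        gcongr
    _ = (1 + 3 * z) ^ m := by rw [hm, pow_add, mul_comm]

theorem insert_same [DecidableEq ι] (hφ : IsLengthWeight g z U φ) (hz : 0 ≤ z) {i : ι} (hi : i ∉ U)
    (h : ∀ h, z * φ h ≤ φ (h + g i)) : IsLengthWeight g z (insert i U) φ where
  nonneg := hφ.nonneg
  one_le := hφ.one_le
  mul_le j hj := by
    rcases Finset.mem_insert.1 hj with rfl | hj
    · exact h
    · exact hφ.mul_le j hj
  sum_cube_le := hφ.cube_le_of_factor hz hφ.nonneg (c := 1) (k := 1) (by simp) (by linarith)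
    (Finset.card_insert_of_notMem hi)

variable [DecidableEq ι] [Module (ZMod 2) G]

theorem add_add_cancel_two {G : Type*} [AddCommGroup G] [Module (ZMod 2) G] (x y : G) :
    x + y + y = x := by
  rw [add_assoc, ZModModule.add_self, add_zero]

/-- A relation `g i = g j` with both coordinates new. -/
theorem insert_pair (hφ : IsLengthWeight g z U φ) (hz : 0 ≤ z) (hz1 : z ≤ 1) {i j : ι}
    (hi : i ∉ U) (hj : j ∉ U) (hij : i ≠ j) (hg : g i = g j) :
    ∃ φ', IsLengthWeight g z (insert i (insert j U)) φ' := by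
  have hn := hφ.nonneg
  have hn' : ∀ h, 0 ≤ φ h + z * φ (h + g i) := fun h => by
    have := hn h; have := hn (h + g i); positivity
  have hmul : ∀ h, z * (φ h + z * φ (h + g i)) ≤ φ (h + g i) + z * φ (h + g i + g i) := by
    intro h
    rw [add_add_cancel_two]
    nlinarith [hn (h + g i), hn h, mul_nonneg hz (hn (h + g i)),
      mul_le_mul_of_nonneg_right hz1 (hn (h + g i))]
  refine ⟨fun h => φ h + z * φ (h + g i), hn', ?_, ?_, ?_⟩
  · have := mul_nonneg hz (hn (0 + g i))
    linarith [hφ.one_le]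
  · intro l hl h
    rcases Finset.mem_insert.1 hl with rfl | hl
    · exact hmul h
    rcases Finset.mem_insert.1 hl with rfl | hl
    · simpa only [hg] using hmul h
    · have h1 := hφ.mul_le l hl h
      have h2 := mul_le_mul_of_nonneg_left (hφ.mul_le l hl (h + g i)) hz
      rw [add_right_comm] at h2
      linarith
  · refine hφ.cube_le_of_factor hz hn' (c := 1 + z) (k := 2) ?_ ?_ ?_
    · rw [Finset.sum_add_distrib, ← Finset.mul_sum, sum_translate]
      linarith
    · nlinarith [mul_nonneg hz hz, mul_le_mul_of_nonneg_left hz1 (mul_nonneg hz hz)]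
    · rw [Finset.card_insert_of_notMem (by simp [hij, hi]), Finset.card_insert_of_notMem hj]

/-- A relation `g i = g j + g k` with all three coordinates new. -/
theorem insert_triple (hφ : IsLengthWeight g z U φ) (hz : 0 ≤ z) (hz1 : z ≤ 1) {i j k : ι}
    (hi : i ∉ U) (hj : j ∉ U) (hk : k ∉ U) (hij : i ≠ j) (hik : i ≠ k) (hjk : j ≠ k)
    (hg : g i = g j + g k) :
    ∃ φ', IsLengthWeight g z (insert i (insert j (insert k U))) φ' := by
  have hn := hφ.nonneg
  set φ' : G → ℝ := fun h => φ h + z * (φ (h + g i) + φ (h + g j) + φ (h + g k)) with hφ'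
  have hn' : ∀ h, 0 ≤ φ' h := fun h => by
    have := hn h; have := hn (h + g i); have := hn (h + g j); have := hn (h + g k)
    simp only [hφ']; positivity
  have key : ∀ a b c d : ℝ, 0 ≤ a → 0 ≤ b → 0 ≤ c → 0 ≤ d →
      z * (a + z * (b + c + d)) ≤ b + z * (a + c + d) := by
    intro a b c d ha hb hc hd
    have : z * (z * (b + c + d)) ≤ z * b + z * (c + d) := by
      nlinarith [mul_le_mul_of_nonneg_right hz1 (mul_nonneg hz (add_nonneg (add_nonneg hb hc) hd))]
    nlinarith [mul_le_mul_of_nonneg_right hz1 hb]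
  refine ⟨φ', hn', ?_, ?_, ?_⟩
  · have h1 := hn (0 + g i); have h2 := hn (0 + g j); have h3 := hn (0 + g k)
    have : 0 ≤ z * (φ (0 + g i) + φ (0 + g j) + φ (0 + g k)) := by positivity
    simp only [hφ']
    linarith [hφ.one_le]
  · intro l hl h
    have h1 := hn h; have h2 := hn (h + g i); have h3 := hn (h + g j); have h4 := hn (h + g k)
    have e1 : h + g i + g j = h + g k := by
      rw [hg, ← add_assoc, add_right_comm, add_add_cancel_two]
    have e2 : h + g i + g k = h + g j := by
      rw [hg, ← add_assoc, add_add_cancel_two]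
    have e3 : h + g j + g k = h + g i := by rw [hg, add_assoc]
    rcases Finset.mem_insert.1 hl with rfl | hl
    · simp only [hφ', add_add_cancel_two, e1, e2]
      have := key _ _ _ _ h1 h2 h3 h4
      linarith
    rcases Finset.mem_insert.1 hl with rfl | hl
    · simp only [hφ', add_add_cancel_two, add_right_comm h (g l) (g i), e1, e3]
      have := key _ _ _ _ h1 h3 h2 h4
      linarith
    rcases Finset.mem_insert.1 hl with rfl | hl
    · simp only [hφ', add_add_cancel_two, add_right_comm h (g l) (g i),
        add_right_comm h (g l) (g j), e2, e3]
      have := key _ _ _ _ h1 h4 h3 h2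
      linarith
    · have a1 := hφ.mul_le l hl h
      have a2 := mul_le_mul_of_nonneg_left (hφ.mul_le l hl (h + g i)) hz
      have a3 := mul_le_mul_of_nonneg_left (hφ.mul_le l hl (h + g j)) hz
      have a4 := mul_le_mul_of_nonneg_left (hφ.mul_le l hl (h + g k)) hz
      rw [add_right_comm] at a2 a3 a4
      simp only [hφ']
      linarith
  · refine hφ.cube_le_of_factor hz hn' (c := 1 + 3 * z) (k := 3) ?_ le_rfl ?_
    · simp only [hφ']
      rw [Finset.sum_add_distrib, ← Finset.mul_sum, Finset.sum_add_distrib,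
        Finset.sum_add_distrib, sum_translate, sum_translate, sum_translate]
      linarith
    · rw [Finset.card_insert_of_notMem (by simp [hij, hik, hi]),
        Finset.card_insert_of_notMem (by simp [hjk, hj]), Finset.card_insert_of_notMem hk]

/-- A relation `g i = g j + g k` with `j` already covered. -/
theorem insert_pair_of_mem (hφ : IsLengthWeight g z U φ) (hz : 0 ≤ z) (hz1 : z ≤ 1) {i j k : ι}
    (hi : i ∉ U) (hj : j ∈ U) (hk : k ∉ U) (hik : i ≠ k) (hg : g i = g j + g k) :
    ∃ φ', IsLengthWeight g z (insert i (insert k U)) φ' := by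
  have hn := hφ.nonneg
  set M : G → ℝ := fun h => max (φ h) (φ (h + g j)) with hM
  have hM0 : ∀ h, 0 ≤ M h := fun h => (hn h).trans (le_max_left _ _)
  have hMj : ∀ h, M (h + g j) = M h := fun h => by
    simp only [hM, add_add_cancel_two]; exact max_comm _ _
  have hMle : ∀ h, z * M h ≤ φ h := by
    intro h
    rcases max_cases (φ h) (φ (h + g j)) with ⟨e, -⟩ | ⟨e, -⟩
    · simp only [hM, e]
      nlinarith [hn h]
    · have := hφ.mul_le j hj (h + g j)
      rw [add_add_cancel_two] at this
      simpa only [hM, e] using this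
  have hsum : (1 + z) * ∑ h, M h ≤ 2 * ∑ h, φ h := by
    have h1 : ∀ h, (1 + z) * M h ≤ φ h + φ (h + g j) := by
      intro h
      have a := hMle h
      have b := hMle (h + g j)
      rw [hMj] at b
      rcases max_cases (φ h) (φ (h + g j)) with ⟨e, -⟩ | ⟨e, -⟩
      · have : M h = φ h := e
        linarith
      · have : M h = φ (h + g j) := e
        linarith
    calc (1 + z) * ∑ h, M h = ∑ h, (1 + z) * M h := Finset.mul_sum ..
      _ ≤ ∑ h, (φ h + φ (h + g j)) := Finset.sum_le_sum fun h _ => h1 h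
      _ = 2 * ∑ h, φ h := by rw [Finset.sum_add_distrib, sum_translate]; ring
  set φ' : G → ℝ := fun h => φ h + z * M (h + g i) with hφ'
  have hn' : ∀ h, 0 ≤ φ' h := fun h => add_nonneg (hn h) (mul_nonneg hz (hM0 _))
  have hki : g k = g j + g i := by 
    rw [hg, ← add_assoc, ZModModule.add_self, zero_add]
  have key : ∀ a b c m : ℝ, 0 ≤ m → z * m ≤ a → b ≤ c → z * (b + z * m) ≤ a + z * c := by
    intro a b c m hm h1 h2
    have := mul_le_mul_of_nonneg_left h2 hz
    have := mul_le_mul_of_nonneg_right hz1 (mul_nonneg hz hm)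
    nlinarith
  refine ⟨φ', hn', ?_, ?_, ?_⟩
  · have := mul_nonneg hz (hM0 (0 + g i))
    simp only [hφ']
    linarith [hφ.one_le]
  · intro l hl h
    rcases Finset.mem_insert.1 hl with rfl | hl
    · simp only [hφ', add_add_cancel_two]
      exact key _ _ _ _ (hM0 _) (hMle _) (le_max_left _ _)
    rcases Finset.mem_insert.1 hl with rfl | hl
    · simp only [hφ', hki, ← add_assoc, add_add_cancel_two, hMj]
      refine key _ _ _ _ (hM0 _) ?_ (le_max_left _ _)
      rw [← hMj, add_right_comm]
      exact hMle _
    · have a1 := hφ.mul_le l hl h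
      have a2 : z * M (h + g i) ≤ M (h + g l + g i) := by
        rw [add_right_comm]
        simp only [hM, mul_max_of_nonneg _ _ hz]
        refine max_le_max (hφ.mul_le l hl _) ?_
        rw [add_right_comm _ (g l)]
        exact hφ.mul_le l hl _
      have := mul_le_mul_of_nonneg_left a2 hz
      simp only [hφ']
      linarith
  · have hz' : 0 < 1 + z := by linarith
    refine hφ.cube_le_of_factor hz hn' (c := (1 + 3 * z) / (1 + z)) (k := 2) ?_ ?_ ?_
    · simp only [hφ']
      rw [Finset.sum_add_distrib, ← Finset.mul_sum, sum_translate, div_mul_eq_mul_div,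
        le_div_iff₀ hz']
      nlinarith [mul_le_mul_of_nonneg_left hsum hz]
    · rw [div_pow, div_le_iff₀ (by positivity)]
      have : 1 + 3 * z ≤ (1 + z) ^ 3 := by nlinarith [mul_nonneg hz hz, pow_nonneg hz 3]
      calc (1 + 3 * z) ^ 3 = (1 + 3 * z) ^ 2 * (1 + 3 * z) := by ring
        _ ≤ _ := by gcongr
    · rw [Finset.card_insert_of_notMem (by simp [hik, hi]), Finset.card_insert_of_notMem hk]

/-- A relation `g i = g j + g k` with `j` and `k` already covered. -/
theorem insert_of_mem (hφ : IsLengthWeight g z U φ) (hz : 0 ≤ z) (hz1 : z ≤ 1) {i j k : ι}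
    (hi : i ∉ U) (hj : j ∈ U) (hk : k ∈ U) (hg : g i = g j + g k) :
    ∃ φ', IsLengthWeight g z (insert i U) φ' := by
  have hn := hφ.nonneg
  set φ' : G → ℝ := fun h => max (φ h) (z * φ (h + g i)) with hφ'
  have hn' : ∀ h, 0 ≤ φ' h := fun h => (hn h).trans (le_max_left _ _)
  have hi2 : ∀ h, z ^ 2 * φ h ≤ φ (h + g i) := by
    intro h
    rw [hg, ← add_assoc, sq, mul_assoc]
    exact (mul_le_mul_of_nonneg_left (hφ.mul_le j hj h) hz).trans (hφ.mul_le k hk _)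
  have key : ∀ a b : ℝ, 0 ≤ a → 0 ≤ b → z ^ 2 * a ≤ b → z ^ 2 * b ≤ a →
      (1 + z ^ 2) * (max a (z * b) + max b (z * a)) ≤ (1 + z) * (a + b) := by
    intro a b ha hb h1 h2
    have hz2 : z ^ 2 ≤ z := by nlinarith
    have hzz := mul_nonneg hz (sub_nonneg.2 hz1)
    rcases max_cases a (z * b) with ⟨e, h⟩ | ⟨e, h⟩ <;>
    rcases max_cases b (z * a) with ⟨e', h'⟩ | ⟨e', h'⟩ <;> rw [e, e']
    · nlinarith [mul_nonneg hzz (add_nonneg ha hb)]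
    · nlinarith [mul_nonneg hz (sub_nonneg.2 h1)]
    · nlinarith [mul_nonneg hz (sub_nonneg.2 h2)]
    · nlinarith [mul_le_mul_of_nonneg_right hz1 ha, mul_le_mul_of_nonneg_right hz1 hb]
  refine ⟨φ', hn', hφ.one_le.trans (le_max_left _ _), ?_, ?_⟩
  · intro l hl h
    rcases Finset.mem_insert.1 hl with rfl | hl
    · simp only [hφ', add_add_cancel_two, mul_max_of_nonneg _ _ hz]
      refine max_le (le_max_right _ _) (le_max_of_le_left ?_)
      have := hn (h + g l)
      nlinarith [mul_le_mul_of_nonneg_right hz1 (mul_nonneg hz this),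
        mul_le_mul_of_nonneg_right hz1 this]
    · simp only [hφ', mul_max_of_nonneg _ _ hz]
      refine max_le_max (hφ.mul_le l hl h) (mul_le_mul_of_nonneg_left ?_ hz)
      rw [add_right_comm]
      exact hφ.mul_le l hl _
  · have hz' : 0 < 1 + z ^ 2 := by positivity
    refine hφ.cube_le_of_factor hz hn' (c := (1 + z) / (1 + z ^ 2)) (k := 1) ?_ ?_ ?_
    · rw [div_mul_eq_mul_div, le_div_iff₀ hz']
      have h1 : ∑ h, (1 + z ^ 2) * (φ' h + φ' (h + g i)) ≤ ∑ h, (1 + z) * (φ h + φ (h + g i)) := by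
        refine Finset.sum_le_sum fun h _ => ?_
        simp only [hφ', add_add_cancel_two]
        refine key _ _ (hn _) (hn _) (hi2 h) ?_
        simpa only [add_add_cancel_two] using hi2 (h + g i)
      rw [← Finset.mul_sum, ← Finset.mul_sum, Finset.sum_add_distrib, Finset.sum_add_distrib,
        sum_translate, sum_translate] at h1
      linarith
    · rw [div_pow, div_le_iff₀ (by positivity)]
      have h3 := pow_nonneg hz 3
      have : 0 ≤ (1 + 3 * z) * (1 + z ^ 2) ^ 3 - (1 + z) ^ 3 := by
        have : (1 + 3 * z) * (1 + z ^ 2) ^ 3 - (1 + z) ^ 3 =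
          8 * z ^ 3 + 3 * z ^ 4 + 9 * z ^ 5 + z ^ 6 + 3 * z ^ 7 := by ring
        rw [this]; positivity
      linarith
    · exact Finset.card_insert_of_notMem hi

theorem exists_ssuperset (hφ : IsLengthWeight g z U φ) (hz : 0 ≤ z) (hz1 : z ≤ 1) {i : ι}
    (hi : i ∉ U) {T : Finset ι} (hiT : i ∉ T) (hT : T.card ≤ 2) (hg : g i = ∑ j ∈ T, g j) :
    ∃ W φ', U ⊂ W ∧ IsLengthWeight g z W φ' := by
  have hss : ∀ W : Finset ι, U ⊆ W → U ⊂ insert i W := fun W hUW =>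
    ⟨hUW.trans (Finset.subset_insert _ _), fun h => hi (h (Finset.mem_insert_self _ _))⟩
  have key : T.card = 0 ∨ T.card = 1 ∨ T.card = 2 := by omega
  rcases key with h | h | h
  · rw [Finset.card_eq_zero] at h
    subst h
    refine ⟨_, φ, hss U le_rfl, hφ.insert_same hz hi fun h => ?_⟩
    rw [hg, Finset.sum_empty, add_zero]
    exact mul_le_of_le_one_left (hφ.nonneg _) hz1
  · obtain ⟨j, rfl⟩ := Finset.card_eq_one.1 h
    rw [Finset.sum_singleton] at hg
    by_cases hj : j ∈ U
    · exact ⟨_, φ, hss U le_rfl, hφ.insert_same hz hi fun h => hg ▸ hφ.mul_le j hj h⟩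
    · obtain ⟨φ', hW⟩ := hφ.insert_pair hz hz1 hi hj (by simpa using hiT) hg
      exact ⟨_, φ', hss _ (Finset.subset_insert _ _), hW⟩
  · obtain ⟨j, k, hjk, rfl⟩ := Finset.card_eq_two.1 h
    rw [Finset.sum_pair hjk] at hg
    simp only [Finset.mem_insert, Finset.mem_singleton, not_or] at hiT
    by_cases hj : j ∈ U <;> by_cases hk : k ∈ U
    · obtain ⟨φ', hW⟩ := hφ.insert_of_mem hz hz1 hi hj hk hg
      exact ⟨_, φ', hss _ le_rfl, hW⟩
    · obtain ⟨φ', hW⟩ := hφ.insert_pair_of_mem hz hz1 hi hj hk hiT.2 hg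
      exact ⟨_, φ', hss _ (Finset.subset_insert _ _), hW⟩
    · obtain ⟨φ', hW⟩ := hφ.insert_pair_of_mem hz hz1 hi hk hj hiT.1 (by rw [hg, add_comm])
      exact ⟨_, φ', hss _ (Finset.subset_insert _ _), hW⟩
    · obtain ⟨φ', hW⟩ := hφ.insert_triple hz hz1 hi hj hk hiT.1 hiT.2 hjk hg
      exact ⟨_, φ', hss _ ((Finset.subset_insert _ _).trans (Finset.subset_insert _ _)), hW⟩

/-- If every generator is a sum of at most two others, then the ball growth of the Cayley graph is
at most that of `K₄ ^ (|ι| / 3)`. -/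
theorem exists_univ [Fintype ι] (hz : 0 ≤ z) (hz1 : z ≤ 1)
    (hg : ∀ i, ∃ T : Finset ι, i ∉ T ∧ T.card ≤ 2 ∧ g i = ∑ j ∈ T, g j) :
    ∃ φ, IsLengthWeight g z Finset.univ φ := by
  classical
  have h0 : IsLengthWeight g z ∅ (Pi.single 0 1) := by
    refine ⟨fun h => ?_, by simp, by simp, by simp⟩
    rw [Pi.single_apply]
    split_ifs <;> norm_num
  obtain ⟨U, -, hU⟩ := (Set.toFinite {U | ∃ φ, IsLengthWeight g z U φ}).exists_le_maximal
    (a := ∅) ⟨_, h0⟩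
  obtain ⟨φ, hφ⟩ := hU.prop
  by_cases h : U = Finset.univ
  · exact ⟨φ, h ▸ hφ⟩
  · obtain ⟨i, hi⟩ : ∃ i, i ∉ U := by
      by_contra! hc
      exact h (Finset.eq_univ_iff_forall.2 hc)
    obtain ⟨T, hiT, hT, hgi⟩ := hg i
    obtain ⟨W, φ', hW, h'⟩ := hφ.exists_ssuperset hz hz1 hi hiT hT hgi
    exact absurd hW (hU.not_gt ⟨φ', h'⟩)

end IsLengthWeight

section Coset

variable {n : ℕ}

theorem sum_single_of_support (x : Fin n → ZMod 2) :
    ∑ i ∈ Finset.univ.filter (x · ≠ 0), Pi.single i (1 : ZMod 2) = x := by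
  ext k
  rw [Finset.sum_apply]
  simp only [Pi.single_apply]
  rw [Finset.sum_ite_eq]
  have : ∀ a : ZMod 2, a ≠ 0 → a = 1 := by decide
  by_cases h : x k = 0
  · simp [h]
  · simp [this _ h]

/-- In the absence of codewords of weight one, every coordinate is involved in a check. -/
theorem exists_mem_dualCode_apply_ne_zero_s16 (C : Submodule (ZMod 2) (Fin n → ZMod 2)) (i : Fin n)
    (hi : Pi.single i 1 ∉ C) : ∃ d ∈ dualCode C, d i ≠ 0 := by
  obtain ⟨f, hf, hC⟩ := Submodule.exists_dual_map_eq_bot_of_notMem hi inferInstance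
  refine ⟨fun j => f (Pi.single j 1), fun c hc => ?_, hf⟩
  have h0 : f c = 0 := by
    have : f c ∈ C.map f := Submodule.mem_map_of_mem hc
    rwa [hC, Submodule.mem_bot] at this
  rw [← h0]
  conv_rhs => rw [pi_eq_sum_univ' c, map_sum]
  refine Finset.sum_congr rfl fun j _ => ?_
  rw [map_smul, smul_eq_mul, mul_comm]

theorem exists_check_apply_ne_zero {D : Submodule (ZMod 2) (Fin n → ZMod 2)}
    {S : Set (Fin n → ZMod 2)} (hS : Submodule.span (ZMod 2) S = D) {i : Fin n}
    (h : ∃ d ∈ D, d i ≠ 0) : ∃ s ∈ S, s i ≠ 0 := by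
  by_contra! hc
  obtain ⟨d, hd, hdi⟩ := h
  have hle : Submodule.span (ZMod 2) S ≤ LinearMap.ker (LinearMap.proj (R := ZMod 2) i) :=
    Submodule.span_le.2 fun s hs => hc s hs
  exact hdi (hle (hS ▸ hd))

/-- A check of weight at most three through `i` writes the `i`-th generator of the coset graph as a
sum of at most two other generators. -/
theorem generator_eq_sum_of_check {D : Submodule (ZMod 2) (Fin n → ZMod 2)}
    {s : Fin n → ZMod 2} (hs : s ∈ D) (hw : hammingNorm s ≤ 3) {i : Fin n} (hi : s i ≠ 0) :
    ∃ T : Finset (Fin n), i ∉ T ∧ T.card ≤ 2 ∧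
      D.mkQ (Pi.single i 1) = ∑ j ∈ T, D.mkQ (Pi.single j 1) := by
  have hmem : i ∈ Finset.univ.filter (s · ≠ 0) := by simpa using hi
  refine ⟨(Finset.univ.filter (s · ≠ 0)).erase i, Finset.notMem_erase _ _, ?_, ?_⟩
  · rw [Finset.card_erase_of_mem hmem]
    have : (Finset.univ.filter (s · ≠ 0)).card ≤ 3 := hw
    omega
  · have h0 : D.mkQ s = 0 := by simpa using hs
    rw [← sum_single_of_support s, map_sum, ← Finset.add_sum_erase _ _ hmem] at h0
    rw [eq_neg_of_add_eq_zero_left h0, ZModModule.neg_eq_self]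

/-- The number of cosets of `D` that meet a Hamming ball, for `D` with a spanning set of checks of
weight at most three that cover all coordinates. -/
theorem card_image_ball_le {D : Submodule (ZMod 2) (Fin n → ZMod 2)} {z : ℝ} (hz : 0 < z)
    (hz1 : z ≤ 1) (hD : ∀ i, ∃ s ∈ D, hammingNorm s ≤ 3 ∧ s i ≠ 0) (r : ℕ)
    (B : Finset ((Fin n → ZMod 2) ⧸ D))
    (hB : ∀ b ∈ B, ∃ x, hammingNorm x ≤ r ∧ D.mkQ x = b) :
    ((B.card : ℝ) * z ^ r) ^ 3 ≤ (1 + 3 * z) ^ n := by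
  classical
  have : Fintype ((Fin n → ZMod 2) ⧸ D) := Fintype.ofFinite _
  obtain ⟨φ, hφ⟩ := IsLengthWeight.exists_univ (g := fun i => D.mkQ (Pi.single i 1)) hz.le hz1
    fun i => by
      obtain ⟨s, hs, hw, hi⟩ := hD i
      exact generator_eq_sum_of_check hs hw hi
  have hb : ∀ b ∈ B, z ^ r ≤ φ b := by
    intro b hb
    obtain ⟨x, hx, rfl⟩ := hB b hb
    have := hφ.pow_card_le hz.le (Finset.univ.filter (x · ≠ 0)) (Finset.subset_univ _)
    rw [← map_sum, sum_single_of_support] at this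
    exact (pow_le_pow_of_le_one hz.le hz1 hx).trans this
  have h1 : (B.card : ℝ) * z ^ r ≤ ∑ h, φ h := by
    rw [← nsmul_eq_mul]
    exact (Finset.card_nsmul_le_sum _ _ _ hb).trans
      (Finset.sum_le_sum_of_subset_of_nonneg (Finset.subset_univ _) fun h _ _ => hφ.nonneg h)
  have h2 := hφ.sum_cube_le
  rw [Finset.card_univ, Fintype.card_fin] at h2
  exact (pow_le_pow_left₀ (by positivity) h1 3).trans h2

end Coset

section Spectral

variable {n : ℕ}

/-- The nontrivial real character of `ZMod 2`. -/
def binarySign (a : ZMod 2) : ℝ := if a = 0 then 1 else -1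

theorem binarySign_zero : binarySign 0 = 1 := if_pos rfl

theorem binarySign_add (a b : ZMod 2) : binarySign (a + b) = binarySign a * binarySign b := by
  have h : ∀ a : ZMod 2, a = 0 ∨ a = 1 := by decide
  have h2 : (1 : ZMod 2) + 1 = 0 := by decide
  rcases h a with rfl | rfl <;> rcases h b with rfl | rfl <;> simp [binarySign, h2]

theorem sum_binarySign (c : Fin n → ZMod 2) :
    ∑ i, binarySign (c i) = n - 2 * hammingNorm c := by
  have h : ∀ i, binarySign (c i) = 1 - 2 * if c i ≠ 0 then 1 else 0 := by
    intro i
    by_cases h : c i = 0 <;> simp [binarySign, h]; norm_num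
  rw [Finset.sum_congr rfl fun i _ => h i, Finset.sum_sub_distrib, ← Finset.mul_sum,
    Finset.sum_boole]
  simp [hammingNorm]

theorem sum_code_binarySign (C : Submodule (ZMod 2) (Fin n → ZMod 2)) [Fintype C]
    [DecidablePred (· ∈ dualCode C)] (x : Fin n → ZMod 2) :
    ∑ c : C, binarySign (x ⬝ᵥ c) = if x ∈ dualCode C then (Fintype.card C : ℝ) else 0 := by
  split_ifs with h
  · have : ∀ c : C, binarySign (x ⬝ᵥ c) = 1 := fun c => by
      rw [show x ⬝ᵥ (c : Fin n → ZMod 2) = 0 from h c c.2, binarySign_zero]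
    simp [this]
  · obtain ⟨c₀, hc₀⟩ : ∃ c₀ : C, x ⬝ᵥ (c₀ : Fin n → ZMod 2) ≠ 0 := by
      by_contra! hc
      exact h fun c hcC => hc ⟨c, hcC⟩
    have h1 : ∑ c : C, binarySign (x ⬝ᵥ ((c + c₀ : C) : Fin n → ZMod 2)) =
        ∑ c : C, binarySign (x ⬝ᵥ c) := Equiv.sum_comp (Equiv.addRight c₀)
          fun c : C => binarySign (x ⬝ᵥ (c : Fin n → ZMod 2))
    simp only [Submodule.coe_add, dotProduct_add, binarySign_add, ← Finset.sum_mul] at h1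
    rw [show binarySign (x ⬝ᵥ (c₀ : Fin n → ZMod 2)) = -1 from if_neg hc₀] at h1
    linarith

/-- The Fourier transform on the Hamming cube. -/
noncomputable def cubeFourier (f : (Fin n → ZMod 2) → ℝ) (c : Fin n → ZMod 2) : ℝ :=
  ∑ x, f x * binarySign (x ⬝ᵥ c)

/-- The adjacency operator of the Hamming cube. -/
noncomputable def cubeAdj (f : (Fin n → ZMod 2) → ℝ) (x : Fin n → ZMod 2) : ℝ :=
  ∑ i, f (x + Pi.single i 1)

theorem cubeFourier_cubeAdj (f : (Fin n → ZMod 2) → ℝ) (c : Fin n → ZMod 2) :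
    cubeFourier (cubeAdj f) c = (n - 2 * hammingNorm c) * cubeFourier f c := by
  have h : ∀ i, ∑ x, f (x + Pi.single i 1) * binarySign (x ⬝ᵥ c) =
      binarySign (c i) * cubeFourier f c := by
    intro i
    rw [← Equiv.sum_comp (Equiv.addRight (Pi.single i (1 : ZMod 2))), cubeFourier, Finset.mul_sum]
    refine Finset.sum_congr rfl fun x _ => ?_
    rw [Equiv.coe_addRight, IsLengthWeight.add_add_cancel_two, add_dotProduct, binarySign_add,
      single_dotProduct, one_mul]
    ring
  simp only [cubeFourier, cubeAdj, Finset.sum_mul]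
  rw [Finset.sum_comm, Finset.sum_congr rfl fun i _ => h i, ← Finset.sum_mul, sum_binarySign]
  rfl

/-- Parseval's identity for the restriction of the Fourier transform to a code. -/
theorem sum_cubeFourier_mul (C : Submodule (ZMod 2) (Fin n → ZMod 2)) [Fintype C]
    [DecidablePred (· ∈ dualCode C)] (f h : (Fin n → ZMod 2) → ℝ) :
    ∑ c : C, cubeFourier f c * cubeFourier h c =
      Fintype.card C * ∑ x, ∑ y, if x + y ∈ dualCode C then f x * h y else 0 := by
  have h1 : ∀ c : C, cubeFourier f c * cubeFourier h c =
      ∑ x, ∑ y, f x * h y * binarySign ((x + y) ⬝ᵥ (c : Fin n → ZMod 2)) := by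
    intro c
    rw [cubeFourier, cubeFourier, Finset.sum_mul_sum]
    refine Finset.sum_congr rfl fun x _ => Finset.sum_congr rfl fun y _ => ?_
    rw [add_dotProduct, binarySign_add]
    ring
  rw [Finset.sum_congr rfl fun c _ => h1 c, Finset.sum_comm, Finset.mul_sum]
  refine Finset.sum_congr rfl fun x _ => ?_
  rw [Finset.sum_comm, Finset.mul_sum]
  refine Finset.sum_congr rfl fun y _ => ?_
  rw [← Finset.mul_sum, sum_code_binarySign]
  split_ifs <;> ring

/-- The Cauchy–Schwarz inequality on the cosets that meet the support of `f`. -/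
theorem sq_sum_le_card_mul_sum_coset {D : Submodule (ZMod 2) (Fin n → ZMod 2)}
    [DecidablePred (· ∈ D)] (f : (Fin n → ZMod 2) → ℝ) (B : Finset ((Fin n → ZMod 2) ⧸ D))
    (hB : ∀ x, f x ≠ 0 → D.mkQ x ∈ B) :
    (∑ x, f x) ^ 2 ≤ B.card * ∑ x, ∑ y, if x + y ∈ D then f x * f y else 0 := by
  classical
  have h1 : ∑ x, f x = ∑ b ∈ B, ∑ x, if D.mkQ x = b then f x else 0 := by
    rw [Finset.sum_comm]
    refine Finset.sum_congr rfl fun x _ => ?_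
    rw [Finset.sum_ite_eq]
    split_ifs with h
    · rfl
    · by_contra h'
      exact h (hB x h')
  have h2 : ∑ x, ∑ y, (if x + y ∈ D then f x * f y else 0) =
      ∑ b ∈ B, (∑ x, if D.mkQ x = b then f x else 0) ^ 2 := by
    have : ∀ b : (Fin n → ZMod 2) ⧸ D, (∑ x, if D.mkQ x = b then f x else 0) ^ 2 =
        ∑ x, ∑ y, if D.mkQ x = b then (if D.mkQ y = b then f x * f y else 0) else 0 := by
      intro b
      rw [sq, Finset.sum_mul_sum]
      refine Finset.sum_congr rfl fun x _ => Finset.sum_congr rfl fun y _ => ?_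
      split_ifs <;> simp
    rw [Finset.sum_congr rfl fun b _ => this b, Finset.sum_comm (s := B)]
    refine Finset.sum_congr rfl fun x _ => ?_
    rw [Finset.sum_comm (s := B)]
    refine Finset.sum_congr rfl fun y _ => ?_
    rw [Finset.sum_ite_eq]
    have hiff : x + y ∈ D ↔ D.mkQ y = D.mkQ x := by
      rw [Submodule.mkQ_apply, Submodule.mkQ_apply, Submodule.Quotient.eq, ZModModule.sub_eq_add,
        add_comm]
    by_cases hx : f x = 0
    · simp [hx]
    · simp only [hiff, if_pos (hB x hx)]
  rw [h1, h2]
  exact sq_sum_le_card_mul_sum_sq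

/-- The Friedman–Tillich bound: a nonnegative function on the cube whose adjacency eigenvalue beats
the second eigenvalue of the coset graph bounds the size of the code by the number of cosets it
meets. -/
theorem card_code_mul_le (C : Submodule (ZMod 2) (Fin n → ZMod 2)) {d l : ℝ}
    (hC : ∀ c ∈ C, c ≠ 0 → d ≤ (hammingNorm c : ℝ)) (f : (Fin n → ZMod 2) → ℝ)
    (hf : ∀ x, 0 ≤ f x) (hpos : 0 < ∑ x, f x) (hl : ∀ x, l * f x ≤ cubeAdj f x)
    (B : Finset ((Fin n → ZMod 2) ⧸ dualCode C))
    (hB : ∀ x, f x ≠ 0 → (dualCode C).mkQ x ∈ B) (hld : n - 2 * d ≤ l) :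
    (l - (n - 2 * d)) * Nat.card C ≤ 2 * d * B.card := by
  classical
  have : Fintype C := Fintype.ofFinite _
  rw [Nat.card_eq_fintype_card]
  set Q := ∑ x, ∑ y, if x + y ∈ dualCode C then f x * f y else 0 with hQ
  have hparseval := sum_cubeFourier_mul C f f
  have hadj := sum_cubeFourier_mul C f (cubeAdj f)
  have hF0 : cubeFourier f 0 = ∑ x, f x := by
    simp [cubeFourier, binarySign_zero]
  have h1 : l * Q ≤ ∑ x, ∑ y, if x + y ∈ dualCode C then f x * cubeAdj f y else 0 := by
    rw [hQ, Finset.mul_sum]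
    refine Finset.sum_le_sum fun x _ => ?_
    rw [Finset.mul_sum]
    refine Finset.sum_le_sum fun y _ => ?_
    split_ifs
    · nlinarith [mul_le_mul_of_nonneg_left (hl y) (hf x)]
    · simp
  have h2 : ∑ c : C, cubeFourier f c * cubeFourier (cubeAdj f) c ≤
      (n - 2 * d) * (∑ c : C, cubeFourier f c * cubeFourier f c) + 2 * d * (∑ x, f x) ^ 2 := by
    have h3 : ∀ c : C, cubeFourier f c * cubeFourier (cubeAdj f) c ≤
        (n - 2 * d) * (cubeFourier f c * cubeFourier f c) +
          if c = 0 then 2 * d * (∑ x, f x) ^ 2 else 0 := by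
      intro c
      rw [cubeFourier_cubeAdj]
      split_ifs with hc
      · subst hc
        simp only [Submodule.coe_zero, hammingNorm_zero, hF0]
        apply le_of_eq; push_cast; ring
      · have := hC c c.2 (by simpa using hc)
        nlinarith [mul_le_mul_of_nonneg_right this (mul_self_nonneg (cubeFourier f c))]
    calc _ ≤ _ := Finset.sum_le_sum fun c _ => h3 c
      _ = _ := by rw [Finset.sum_add_distrib, ← Finset.mul_sum]; simp
  rw [hparseval, hadj] at h2
  have h4 := sq_sum_le_card_mul_sum_coset f B hB
  rw [← hQ] at h2 h4
  have hcard : (0 : ℝ) ≤ Fintype.card C := Nat.cast_nonneg _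
  have h5 : (l - (n - 2 * d)) * (Fintype.card C * Q) ≤ 2 * d * (∑ x, f x) ^ 2 := by
    nlinarith [mul_le_mul_of_nonneg_left h1 hcard]
  have h6 : (l - (n - 2 * d)) * Fintype.card C * (∑ x, f x) ^ 2 ≤
      2 * d * B.card * (∑ x, f x) ^ 2 := by
    calc (l - (n - 2 * d)) * Fintype.card C * (∑ x, f x) ^ 2
        ≤ (l - (n - 2 * d)) * Fintype.card C * (B.card * Q) :=
          mul_le_mul_of_nonneg_left h4 (mul_nonneg (by linarith) hcard)
      _ = B.card * ((l - (n - 2 * d)) * (Fintype.card C * Q)) := by ring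
      _ ≤ B.card * (2 * d * (∑ x, f x) ^ 2) := by gcongr
      _ = _ := by ring
  exact le_of_mul_le_mul_right h6 (by positivity)

end Spectral

section TestFunction

variable {n : ℕ}

theorem hammingNorm_add_single_of_ne_zero {x : Fin n → ZMod 2} {i : Fin n} (h : x i ≠ 0) :
    hammingNorm (x + Pi.single i 1) = hammingNorm x - 1 := by
  have hmem : i ∈ Finset.univ.filter (x · ≠ 0) := by simpa using h
  rw [hammingNorm, hammingNorm, ← Finset.card_erase_of_mem hmem]
  congr 1
  ext j
  have : ∀ a : ZMod 2, a ≠ 0 → a + 1 = 0 := by decide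
  rcases eq_or_ne j i with rfl | hj
  · simp [this _ h]
  · simp [hj]

theorem hammingNorm_add_single_of_eq_zero {x : Fin n → ZMod 2} {i : Fin n} (h : x i = 0) :
    hammingNorm (x + Pi.single i 1) = hammingNorm x + 1 := by
  have hmem : i ∉ Finset.univ.filter (x · ≠ 0) := by simpa using h
  rw [hammingNorm, hammingNorm, ← Finset.card_insert_of_notMem hmem]
  congr 1
  ext j
  rcases eq_or_ne j i with rfl | hj
  · simp [h]
  · simp [hj]

theorem cubeAdj_radial (a : ℕ → ℝ) (x : Fin n → ZMod 2) :
    cubeAdj (fun y => a (hammingNorm y)) x =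
      hammingNorm x * a (hammingNorm x - 1) + (n - hammingNorm x) * a (hammingNorm x + 1) := by
  have h : ∀ i, a (hammingNorm (x + Pi.single i 1)) =
      if x i ≠ 0 then a (hammingNorm x - 1) else a (hammingNorm x + 1) := by
    intro i
    split_ifs with hi
    · rw [hammingNorm_add_single_of_ne_zero hi]
    · rw [hammingNorm_add_single_of_eq_zero (not_not.1 hi)]
  have hc : ((Finset.univ.filter fun i => ¬ x i ≠ 0).card : ℝ) = n - hammingNorm x := by
    have := Finset.card_filter_add_card_filter_not (s := Finset.univ) (fun i => x i ≠ 0)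
    rw [Finset.card_univ, Fintype.card_fin] at this
    rw [eq_sub_iff_add_eq']
    exact_mod_cast this
  rw [cubeAdj, Finset.sum_congr rfl fun i _ => h i, Finset.sum_ite, Finset.sum_const,
    Finset.sum_const, nsmul_eq_mul, nsmul_eq_mul, hc]
  rfl

/-- The tent function of height `h` centred at `m`. -/
noncomputable def tent (m h : ℕ) (i : ℤ) : ℝ := max 0 ((h : ℝ) - |((i - m : ℤ) : ℝ)|)

theorem tent_nonneg (m h : ℕ) (i : ℤ) : 0 ≤ tent m h i := le_max_left _ _

theorem abs_lt_of_tent_pos {m h : ℕ} {i : ℤ} (hi : 0 < tent m h i) : |i - m| < h := by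
  rcases lt_max_iff.1 hi with h' | h'
  · exact absurd h' (lt_irrefl _)
  · have : |((i - m : ℤ) : ℝ)| < h := by linarith
    exact_mod_cast this

theorem mul_tent_le {m h : ℕ} (hh : 1 ≤ h) {i : ℤ} (hi : 0 < tent m h i) :
    2 * (1 - 1 / (h : ℝ)) * tent m h i ≤ tent m h (i - 1) + tent m h (i + 1) := by
  have hh' : (0 : ℝ) < h := by exact_mod_cast hh
  have hlt := abs_lt_of_tent_pos hi
  have e : tent m h i = h - |((i - m : ℤ) : ℝ)| := by
    refine max_eq_right (sub_nonneg.2 ?_)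
    exact_mod_cast hlt.le
  have l1 : (h : ℝ) - |((i - 1 - m : ℤ) : ℝ)| ≤ tent m h (i - 1) := le_max_right _ _
  have l2 : (h : ℝ) - |((i + 1 - m : ℤ) : ℝ)| ≤ tent m h (i + 1) := le_max_right _ _
  rcases eq_or_ne (i - m) 0 with h0 | h0
  · have e1 : i - 1 - m = -1 := by omega
    have e2 : i + 1 - m = 1 := by omega
    rw [e1] at l1
    rw [e2] at l2
    rw [e, h0]
    have : 2 * (1 - 1 / (h : ℝ)) * h = 2 * h - 2 := by field_simp
    norm_num at l1 l2 ⊢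
    norm_num at this
    linarith
  · have habs : |i - 1 - m| + |i + 1 - m| = 2 * |i - m| := by
      rcases lt_or_gt_of_ne h0 with h1 | h1
      · rw [abs_of_neg h1, abs_of_neg (by omega), abs_of_nonpos (by omega)]; ring
      · rw [abs_of_pos h1, abs_of_pos (by omega : 0 < i + 1 - (m : ℤ)),
          abs_of_nonneg (by omega)]; ring
    have habs' : |((i - 1 - m : ℤ) : ℝ)| + |((i + 1 - m : ℤ) : ℝ)| = 2 * |((i - m : ℤ) : ℝ)| := by
      exact_mod_cast habs
    have : 0 ≤ 1 / (h : ℝ) * tent m h i := by positivity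
    nlinarith

/-- A nonnegative function supported on the Hamming ball of radius `s + 2 h` with large
adjacency eigenvalue. -/
theorem exists_cubeAdj_ge {s h : ℕ} (hs : 1 ≤ s) (hh : 1 ≤ h) (hn : s + 2 * h < n) :
    ∃ f : (Fin n → ZMod 2) → ℝ, (∀ x, 0 ≤ f x) ∧ 0 < ∑ x, f x ∧
      (∀ x, f x ≠ 0 → hammingNorm x ≤ s + 2 * h) ∧
      ∀ x, 2 * (1 - 1 / (h : ℝ)) * √(s * (n - (s + 2 * h))) * f x ≤ cubeAdj f x := by
  have hs' : (0 : ℝ) < s := by exact_mod_cast hs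
  have hn' : (0 : ℝ) < n - (s + 2 * h) := by
    rw [sub_pos]; exact_mod_cast hn
  set L := √((s : ℝ) * (n - (s + 2 * h))) with hL
  have hL0 : 0 < L := Real.sqrt_pos.2 (by positivity)
  have hLL : L * L = s * (n - (s + 2 * h)) := Real.mul_self_sqrt (by positivity)
  set t := (s : ℝ) / L with ht
  have ht0 : 0 < t := by positivity
  have htL : t * L = s := div_mul_cancel₀ _ hL0.ne'
  have htn : (n - (s + 2 * h)) * t = L := by
    rw [ht, mul_div_assoc', div_eq_iff hL0.ne', hLL, mul_comm]
  have hu := tent_nonneg (s + h) h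
  set a : ℕ → ℝ := fun i => t ^ i * tent (s + h) h i with ha
  have ha0 : ∀ i, 0 ≤ a i := fun i => mul_nonneg (by positivity) (hu i)
  have hbd : ∀ i : ℕ, 0 < tent (s + h) h i → s < i ∧ i < s + 2 * h := by
    intro i hi
    have := abs_lt.1 (abs_lt_of_tent_pos hi)
    push_cast at this
    omega
  refine ⟨fun x => a (hammingNorm x), fun x => ha0 _, ?_, fun x hx => ?_, fun x => ?_⟩
  · obtain ⟨S, -, hS⟩ := Finset.exists_subset_card_eq
      (s := (Finset.univ : Finset (Fin n))) (n := s + h) (by rw [Finset.card_fin]; omega)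
    refine Finset.sum_pos' (fun x _ => ha0 _) ⟨fun i => if i ∈ S then 1 else 0,
      Finset.mem_univ _, ?_⟩
    have : hammingNorm (fun i => if i ∈ S then (1 : ZMod 2) else 0) = s + h := by
      rw [← hS, hammingNorm]
      congr 1
      ext i
      simp
    rw [this]
    have hh' : (0 : ℝ) < h := by exact_mod_cast hh
    refine mul_pos (by positivity) (lt_max_of_lt_right ?_)
    have : 0 < h := hh
    simpa using this
  · have : 0 < tent (s + h) h (hammingNorm x) :=
      lt_of_le_of_ne (hu _) fun h0 => hx (by simp only [ha, ← h0, mul_zero])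
    exact (hbd _ this).2.le
  · rw [cubeAdj_radial]
    have hw : hammingNorm x ≤ n := by simpa using hammingNorm_le_card_fintype (x := x)
    beta_reduce
    generalize hammingNorm x = w at hw ⊢
    have hw' : (0 : ℝ) ≤ n - w := sub_nonneg.2 (by exact_mod_cast hw)
    rcases (hu w).eq_or_lt with h0 | h0
    · have h1 := ha0 (w - 1)
      have h2 := ha0 (w + 1)
      simp only [ha] at h1 h2 ⊢
      rw [← h0, mul_zero, mul_zero]
      positivity
    · obtain ⟨hsw, hwr⟩ := hbd w h0
      obtain ⟨v, rfl⟩ : ∃ v, w = v + 1 := ⟨w - 1, by omega⟩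
      have ht1 := mul_tent_le hh h0
      have c1 : (s : ℝ) ≤ (v + 1 : ℕ) := by exact_mod_cast hsw.le
      have c2 : (n : ℝ) - (s + 2 * h) ≤ n - (v + 1 : ℕ) := by
        have : ((v + 1 : ℕ) : ℝ) ≤ s + 2 * h := by exact_mod_cast hwr.le
        linarith
      rw [Nat.add_sub_cancel]
      simp only [ha]
      have e1 : (((v + 1 : ℕ) : ℤ) - 1) = (v : ℤ) := by push_cast; ring
      have e2 : (((v + 1 + 1 : ℕ) : ℤ)) = ((v + 1 : ℕ) : ℤ) + 1 := by push_cast; ring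
      rw [e1] at ht1
      rw [e2]
      set p := tent (s + h) h v
      set q := tent (s + h) h (((v + 1 : ℕ) : ℤ) + 1)
      set m := tent (s + h) h ((v + 1 : ℕ) : ℤ)
      have hp : 0 ≤ p := hu _
      have hq : 0 ≤ q := hu _
      calc 2 * (1 - 1 / (h : ℝ)) * L * (t ^ (v + 1) * m)
          = (t ^ (v + 1) * L) * (2 * (1 - 1 / (h : ℝ)) * m) := by ring
        _ ≤ (t ^ (v + 1) * L) * (p + q) := by gcongr
        _ = (t * L) * (t ^ v * p) + L * (t ^ (v + 1) * q) := by ring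
        _ = s * (t ^ v * p) + ((n - (s + 2 * h)) * t) * (t ^ (v + 1) * q) := by rw [htL, htn]
        _ ≤ (v + 1 : ℕ) * (t ^ v * p) + ((n - (v + 1 : ℕ)) * t) * (t ^ (v + 1) * q) := by
          gcongr
        _ = _ := by ring

end TestFunction

section Rate

theorem card_code_mul_pow_le {n : ℕ} {δ c z : ℝ} (hδ : 0 < δ) (hδn : 1 < δ * n) (hc : 0 < c)
    (hz : 0 < z) (hz1 : z ≤ 1) {C : Submodule (ZMod 2) (Fin n → ZMod 2)}
    (hspan : ∃ S : Set (Fin n → ZMod 2), (∀ x ∈ S, hammingNorm x ≤ 3) ∧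
      Submodule.span (ZMod 2) S = dualCode C)
    (hdist : ∀ x ∈ C, x ≠ 0 → δ * n ≤ (hammingNorm x : ℝ)) {s h : ℕ} (hs : 1 ≤ s) (hh : 1 ≤ h)
    (hn : s + 2 * h < n)
    (hl : n - 2 * (δ * n) + c * n ≤ 2 * (1 - 1 / (h : ℝ)) * √(s * (n - (s + 2 * h)))) :
    ((Nat.card C : ℝ) * z ^ (s + 2 * h)) ^ 3 ≤ (2 * δ / c) ^ 3 * (1 + 3 * z) ^ n := by
  classical
  have hn0 : (0 : ℝ) < n := by exact_mod_cast (by omega : 0 < n)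
  have hcov : ∀ i, ∃ s ∈ dualCode C, hammingNorm s ≤ 3 ∧ s i ≠ 0 := by
    intro i
    obtain ⟨S, hS, hSC⟩ := hspan
    have hi : Pi.single i 1 ∉ C := by
      intro hmem
      have h1 := hdist _ hmem (by simp)
      have h2 : hammingNorm (Pi.single i (1 : ZMod 2) : Fin n → ZMod 2) = 1 := by
        simpa using hammingNorm_add_single_of_eq_zero (x := 0) (i := i) rfl
      rw [h2, Nat.cast_one] at h1
      linarith
    obtain ⟨s, hs, hsi⟩ := exists_check_apply_ne_zero hSC
      (exists_mem_dualCode_apply_ne_zero_s16 C i hi)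
    exact ⟨s, hSC ▸ Submodule.subset_span hs, hS s hs, hsi⟩
  obtain ⟨f, hf0, hfpos, hfsupp, hf⟩ := exists_cubeAdj_ge hs hh hn
  set B := (Finset.univ.filter fun x : Fin n → ZMod 2 => hammingNorm x ≤ s + 2 * h).image
    (dualCode C).mkQ with hBdef
  have hB := card_image_ball_le hz hz1 hcov (s + 2 * h) B fun b hb => by
    obtain ⟨x, hx, rfl⟩ := Finset.mem_image.1 hb
    exact ⟨x, (Finset.mem_filter.1 hx).2, rfl⟩
  have hcn : 0 ≤ c * n := by positivity
  have h1 := card_code_mul_le C hdist f hf0 hfpos hf B (fun x hx => Finset.mem_image_of_mem _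
    (Finset.mem_filter.2 ⟨Finset.mem_univ _, hfsupp x hx⟩)) (by linarith)
  have h2 : (Nat.card C : ℝ) ≤ 2 * δ / c * B.card := by
    rw [div_mul_eq_mul_div, le_div_iff₀ hc]
    refine le_of_mul_le_mul_right ?_ hn0
    calc (Nat.card C : ℝ) * c * n = c * n * Nat.card C := by ring
      _ ≤ _ * Nat.card C := mul_le_mul_of_nonneg_right (by linarith) (Nat.cast_nonneg _)
      _ ≤ _ := h1
      _ = _ := by ring
  calc ((Nat.card C : ℝ) * z ^ (s + 2 * h)) ^ 3
      ≤ (2 * δ / c * B.card * z ^ (s + 2 * h)) ^ 3 := by gcongr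
    _ = (2 * δ / c) ^ 3 * (B.card * z ^ (s + 2 * h)) ^ 3 := by ring
    _ ≤ _ := by gcongr

theorem log_maxLDPCCard_le {w n : ℕ} {δ X : ℝ} (hX : 0 ≤ X)
    (h : ∀ C : Submodule (ZMod 2) (Fin n → ZMod 2),
      (∃ S : Set (Fin n → ZMod 2), (∀ x ∈ S, hammingNorm x ≤ w) ∧
        Submodule.span (ZMod 2) S = dualCode C) →
      (∀ c ∈ C, c ≠ 0 → δ * n ≤ (hammingNorm c : ℝ)) → Real.log (Nat.card C) ≤ X) :
    Real.log (maxLDPCCard w n δ) ≤ X := by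
  have hle : maxLDPCCard w n δ ≤ ⌊Real.exp X⌋₊ := by
    refine csSup_le' ?_
    rintro k ⟨C, hspan, hdist, rfl⟩
    refine Nat.le_floor ?_
    rw [← Real.log_le_iff_le_exp (by exact_mod_cast Nat.card_pos)]
    exact h C hspan hdist
  rcases Nat.eq_zero_or_pos (maxLDPCCard w n δ) with h0 | h0
  · simpa [h0] using hX
  · rw [Real.log_le_iff_le_exp (by exact_mod_cast h0)]
    exact (Nat.le_floor_iff (Real.exp_pos _).le).1 hle

theorem eventually_log_maxLDPCCard_three_le {δ τ z : ℝ} (hδ0 : 0 < δ) (hδ2 : δ < 1 / 2)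
    (hτ : τ < 1 / 2) (hδτ : (1 / 2 - δ) ^ 2 < τ * (1 - τ)) (hz : 0 < z) (hz1 : z ≤ 1) :
    ∃ K : ℝ, ∀ᶠ n : ℕ in Filter.atTop, Real.log (maxLDPCCard 3 n δ) ≤
      K + n * (-τ * Real.log z + 1 / 3 * Real.log (1 + 3 * z)) := by
  have hτ1 : 0 < 1 - τ := by linarith
  have hτ0 : 0 < τ := pos_of_mul_pos_left ((sq_nonneg _).trans_lt hδτ) hτ1.le
  obtain ⟨σ, hσ, hστ⟩ := exists_between ((div_lt_iff₀ hτ1).2 hδτ)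
  have hσ0 : 0 < σ := lt_of_le_of_lt (by positivity) hσ
  rw [div_lt_iff₀ hτ1] at hσ
  have hβ : 1 / 2 - δ < √(σ * (1 - τ)) := Real.lt_sqrt_of_sq_lt hσ
  set β := √(σ * (1 - τ)) with hβdef
  set c := β - (1 / 2 - δ) with hcdef
  have hc : 0 < c := sub_pos.2 hβ
  have hβ0 : 0 < β := by linarith
  have hlogz : Real.log z ≤ 0 := Real.log_nonpos hz.le hz1
  have hlog3 : 0 ≤ Real.log (1 + 3 * z) := Real.log_nonneg (by linarith)
  refine ⟨max 0 (Real.log (2 * δ / c)), ?_⟩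
  have ev1 := (tendsto_natCast_atTop_atTop (R := ℝ)).eventually_gt_atTop (1 / δ)
  have ev2 := (tendsto_natCast_atTop_atTop (R := ℝ)).eventually_gt_atTop
    ((2 * β / c + 3) / ((τ - σ) / 2))
  filter_upwards [ev1, ev2] with n hn1 hn2
  rw [div_lt_iff₀' hδ0] at hn1
  rw [div_lt_iff₀' (by linarith)] at hn2
  have hn0 : (0 : ℝ) < n := pos_of_mul_pos_right (zero_lt_one.trans hn1) hδ0.le
  have hmain : 0 ≤ -τ * Real.log z + 1 / 3 * Real.log (1 + 3 * z) := by
    nlinarith [mul_nonneg hτ0.le (neg_nonneg.2 hlogz)]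
  refine log_maxLDPCCard_le (add_nonneg (le_max_left _ _) (mul_nonneg hn0.le hmain)) ?_
  intro C hspan hdist
  have hβc : 0 < 2 * β / c := by positivity
  set s := ⌈σ * n⌉₊ with hs
  set h := ⌊(τ - σ) / 2 * n⌋₊ - 1 with hh
  have hs1 : 1 ≤ s := Nat.one_le_ceil_iff.2 (by positivity)
  have hs2 : σ * n ≤ s := Nat.le_ceil _
  have hs3 : (s : ℝ) < σ * n + 1 := Nat.ceil_lt_add_one (by positivity)
  have hfl : 3 ≤ ⌊(τ - σ) / 2 * n⌋₊ := Nat.le_floor (by push_cast; linarith)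
  have hh1 : 1 ≤ h := by omega
  have hh2 : (h : ℝ) = ⌊(τ - σ) / 2 * n⌋₊ - 1 := by
    rw [hh, Nat.cast_sub (by omega), Nat.cast_one]
  have hfl1 := Nat.floor_le (a := (τ - σ) / 2 * n) (by linarith)
  have hfl2 := Nat.lt_floor_add_one ((τ - σ) / 2 * n)
  have hr : (s : ℝ) + 2 * h ≤ τ * n := by
    rw [hh2]; linarith
  have hrn : s + 2 * h < n := by
    have : (s : ℝ) + 2 * h < n := hr.trans_lt (by nlinarith)
    exact_mod_cast this
  have hhβ : 2 * β / c ≤ h := by rw [hh2]; linarith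
  have hh0 : (0 : ℝ) < h := by linarith
  have hsqrt : β * n ≤ √(s * (n - (s + 2 * h))) := by
    refine Real.le_sqrt_of_sq_le ?_
    rw [mul_pow, hβdef, Real.sq_sqrt (by positivity)]
    have : (1 - τ) * n ≤ n - (s + 2 * h) := by linarith
    calc σ * (1 - τ) * (n : ℝ) ^ 2 = (σ * n) * ((1 - τ) * n) := by ring
      _ ≤ _ := by gcongr
  have hl : n - 2 * (δ * n) + c * n ≤ 2 * (1 - 1 / (h : ℝ)) * √(s * (n - (s + 2 * h))) := by
    have h1 : 2 * β * (1 / (h : ℝ)) ≤ c := by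
      rw [mul_one_div, div_le_iff₀ hh0]
      rw [div_le_iff₀ hc] at hhβ
      linarith
    have h2 : 0 ≤ 1 - 1 / (h : ℝ) := by
      rw [sub_nonneg, div_le_one hh0]
      exact_mod_cast hh1
    calc n - 2 * (δ * n) + c * n = (2 * β - c) * n := by rw [hcdef]; ring
      _ ≤ (2 * β - 2 * β * (1 / (h : ℝ))) * n := by gcongr
      _ = 2 * (1 - 1 / (h : ℝ)) * (β * n) := by ring
      _ ≤ _ := by gcongr
  have key := card_code_mul_pow_le hδ0 hn1 hc hz hz1 hspan hdist hs1 hh1 hrn hl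
  have hcard : (0 : ℝ) < Nat.card C := by exact_mod_cast Nat.card_pos
  have hlog := Real.log_le_log (by positivity) key
  rw [Real.log_pow, Real.log_mul hcard.ne' (by positivity), Real.log_pow,
    Real.log_mul (by positivity) (by positivity), Real.log_pow, Real.log_pow] at hlog
  push_cast at hlog
  have hK := le_max_right 0 (Real.log (2 * δ / c))
  have := mul_le_mul_of_nonpos_right hr hlogz
  linarith

theorem LDPCRate_three_le_of_lt {δ τ z : ℝ} (hδ0 : 0 < δ) (hδ2 : δ < 1 / 2)
    (hτ : τ < 1 / 2) (hδτ : (1 / 2 - δ) ^ 2 < τ * (1 - τ)) (hz : 0 < z) (hz1 : z ≤ 1) :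
    LDPCRate 3 δ ≤ (-τ * Real.log z + 1 / 3 * Real.log (1 + 3 * z)) / Real.log 2 := by
  obtain ⟨K, hK⟩ := eventually_log_maxLDPCCard_three_le hδ0 hδ2 hτ hδτ hz hz1
  have hlog2 : 0 < Real.log 2 := Real.log_pos one_lt_two
  set E := -τ * Real.log z + 1 / 3 * Real.log (1 + 3 * z)
  have hlim : Filter.Tendsto (fun n : ℕ => K / Real.log 2 / n + E / Real.log 2) Filter.atTop
      (nhds (0 + E / Real.log 2)) :=
    (tendsto_const_div_atTop_nhds_zero_nat _).add tendsto_const_nhds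
  rw [zero_add] at hlim
  rw [LDPCRate, ← hlim.limsup_eq]
  refine Filter.limsup_le_limsup ?_ ?_ hlim.isBoundedUnder_le
  · filter_upwards [hK, Filter.eventually_gt_atTop 0] with n hn hn0
    have hn0' : (0 : ℝ) < n := by exact_mod_cast hn0
    calc Real.logb 2 (maxLDPCCard 3 n δ) / n
        ≤ (K + n * E) / Real.log 2 / n := by rw [Real.logb]; gcongr
      _ = _ := by field_simp
  · refine Filter.IsBoundedUnder.isCoboundedUnder_le ⟨0, ?_⟩
    refine Filter.eventually_map.2 (Filter.Eventually.of_forall fun n => ?_)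
    exact div_nonneg (div_nonneg (Real.log_natCast_nonneg _) hlog2.le) (Nat.cast_nonneg _)

theorem LDPCRate_three_le_log {δ ρ z : ℝ} (hδ0 : 0 < δ) (hδ2 : δ < 1 / 2)
    (hρ : ρ = 1 / 2 - √(δ * (1 - δ))) (hz : 0 < z) (hz1 : z ≤ 1) :
    LDPCRate 3 δ ≤ (-ρ * Real.log z + 1 / 3 * Real.log (1 + 3 * z)) / Real.log 2 := by
  have hpos : 0 < δ * (1 - δ) := mul_pos hδ0 (by linarith)
  have hsq : √(δ * (1 - δ)) ^ 2 = δ * (1 - δ) := Real.sq_sqrt hpos.le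
  have hq : 0 < √(δ * (1 - δ)) := Real.sqrt_pos.2 hpos
  have hcont : Continuous fun τ : ℝ =>
      (-τ * Real.log z + 1 / 3 * Real.log (1 + 3 * z)) / Real.log 2 := by fun_prop
  refine ge_of_tendsto ((hcont.tendsto ρ).mono_left (nhdsWithin_le_nhds (s := Set.Ioi ρ))) ?_
  filter_upwards [Ioo_mem_nhdsGT (show ρ < 1 / 2 by linarith)] with τ hτ
  refine LDPCRate_three_le_of_lt hδ0 hδ2 hτ.2 ?_ hz hz1
  have h1 := hτ.1
  have h2 := hτ.2
  nlinarith [mul_pos (sub_pos.2 h1) (show 0 < 1 - τ - ρ by linarith)]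

end Rate

/-- for `δ ∈ (0,1/2)` and `ρ = 1/2 − √(δ(1−δ))`: if `δ ≤ 1/2 − √3/4` then
`R₃(δ) ≤ 2/3`, and if `δ > 1/2 − √3/4` then `R₃(δ) ≤ (2/3) H₄(3ρ)`. -/
theorem LDPCRate_three_le (δ : ℝ) (hδ0 : 0 < δ) (hδ2 : δ < 1 / 2)
    (ρ : ℝ) (hρ : ρ = 1 / 2 - Real.sqrt (δ * (1 - δ))) :
    (δ ≤ 1 / 2 - Real.sqrt 3 / 4 → LDPCRate 3 δ ≤ 2 / 3) ∧
    (1 / 2 - Real.sqrt 3 / 4 < δ → LDPCRate 3 δ ≤ (2 / 3) * quadEnt (3 * ρ)) := by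
  have hlog2 : 0 < Real.log 2 := Real.log_pos one_lt_two
  have hlog4 : Real.log 4 = 2 * Real.log 2 := by
    rw [show (4 : ℝ) = 2 ^ 2 by norm_num, Real.log_pow]; norm_num
  refine ⟨fun _ => ?_, fun hδ => ?_⟩
  · refine (LDPCRate_three_le_log hδ0 hδ2 hρ one_pos le_rfl).trans (le_of_eq ?_)
    rw [Real.log_one, show (1 : ℝ) + 3 * 1 = 4 by norm_num, hlog4]
    field_simp
    ring
  · have hpos : 0 < δ * (1 - δ) := mul_pos hδ0 (by linarith)
    have hsq : √(δ * (1 - δ)) ^ 2 = δ * (1 - δ) := Real.sq_sqrt hpos.le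
    have hq : 0 ≤ √(δ * (1 - δ)) := Real.sqrt_nonneg _
    have h3 : √3 ^ 2 = 3 := Real.sq_sqrt (by norm_num)
    have hρ0 : 0 < ρ := by
      have : √(δ * (1 - δ)) < 1 / 2 := by
        refine lt_of_pow_lt_pow_left₀ 2 (by norm_num) ?_
        nlinarith [mul_pos (sub_pos.2 hδ2) (sub_pos.2 hδ2)]
      linarith
    have hρ4 : ρ ≤ 1 / 4 := by
      have : 1 / 4 ≤ √(δ * (1 - δ)) := by
        refine le_of_sq_le_sq ?_ hq
        nlinarith [Real.sqrt_nonneg 3]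
      linarith
    have hx : 0 < 1 - 3 * ρ := by linarith
    have hz : 0 < ρ / (1 - 3 * ρ) := div_pos hρ0 hx
    refine (LDPCRate_three_le_log hδ0 hδ2 hρ hz ?_).trans (le_of_eq ?_)
    · rw [div_le_one hx]; linarith
    · have e : 1 + 3 * (ρ / (1 - 3 * ρ)) = (1 - 3 * ρ)⁻¹ := by
        field_simp
        ring
      rw [e, Real.log_inv, Real.log_div hρ0.ne' hx.ne', quadEnt, Real.logb, Real.logb, Real.logb,
        Real.log_mul (by norm_num) hρ0.ne', hlog4]
      field_simp
      ring
end

section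
/- Let w ≥ 3 be an integer and let ρ be a real number with 0 < ρ < 1/2. Then ((1/w) log₂(1 + (ρ/(1−ρ))^w)) / ((log₂ e)/(8w²) · (ρ^w/2)^{w+1}) > w · 2^{w²+w+3}. -/
/-- On `[0, 1]` the function `y ↦ log (1 + y)` dominates `y / 2`. -/
theorem half_le_log_one_add {y : ℝ} (h0 : 0 ≤ y) (h1 : y ≤ 1) : y / 2 ≤ Real.log (1 + y) := by
  refine le_trans ?_ (Real.one_sub_inv_le_log_of_pos (by linarith : 0 < 1 + y))
  have h : 1 - (1 + y)⁻¹ = y / (1 + y) := by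
    field_simp
    ring
  rw [h]
  gcongr
  linarith

theorem two_mul_pow_lt_two_pow_mul_log {w : ℕ} (hw : w ≠ 0) {ρ : ℝ} (hρ0 : 0 < ρ)
    (hρ2 : ρ < 1 / 2) :
    (2 * ρ) ^ (w ^ 2 + w) < 2 ^ (w + 1) * Real.log (1 + (ρ / (1 - ρ)) ^ w) := by
  have h1 : 0 < 1 - ρ := by linarith
  have hx0 : 0 ≤ ρ / (1 - ρ) := by positivity
  have hx1 : ρ / (1 - ρ) ≤ 1 := by
    rw [div_le_one h1]
    linarith
  have hρx : ρ < ρ / (1 - ρ) := by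
    rw [lt_div_iff₀ h1]
    nlinarith
  calc (2 * ρ) ^ (w ^ 2 + w) ≤ (2 * ρ) ^ w :=
        pow_le_pow_of_le_one (by positivity) (by linarith) (Nat.le_add_left _ _)
    _ = 2 ^ w * ρ ^ w := mul_pow _ _ _
    _ < 2 ^ w * (ρ / (1 - ρ)) ^ w := by gcongr
    _ = 2 ^ (w + 1) * ((ρ / (1 - ρ)) ^ w / 2) := by ring
    _ ≤ 2 ^ (w + 1) * Real.log (1 + (ρ / (1 - ρ)) ^ w) := by
        gcongr
        exact half_le_log_one_add (by positivity) (pow_le_one₀ hx0 hx1)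

/-- for an integer `w ≥ 3` and real `0 < ρ < 1/2`,
`((1/w) log₂(1 + (ρ/(1−ρ))^w)) / ((log₂ e)/(8w²) · (ρ^w/2)^{w+1}) > w · 2^{w²+w+3}`. -/
theorem improvement_ratio_gt (w : ℕ) (hw : 3 ≤ w) (ρ : ℝ) (hρ0 : 0 < ρ) (hρ2 : ρ < 1 / 2) :
    ((1 / (w : ℝ)) * Real.logb 2 (1 + (ρ / (1 - ρ)) ^ w)) /
        (Real.logb 2 (Real.exp 1) / (8 * (w : ℝ) ^ 2) * (ρ ^ w / 2) ^ (w + 1))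
      > (w : ℝ) * 2 ^ (w ^ 2 + w + 3) := by
  have hw0 : (0 : ℝ) < w := by
    exact_mod_cast (by omega : 0 < w)
  have hlog2 : 0 < Real.log 2 := Real.log_pos (by norm_num)
  have key := two_mul_pow_lt_two_pow_mul_log (by omega : w ≠ 0) hρ0 hρ2
  simp only [Real.logb, Real.log_exp]
  generalize Real.log (1 + (ρ / (1 - ρ)) ^ w) = L at key ⊢
  have hpow : (ρ ^ w / 2) ^ (w + 1) = ρ ^ (w ^ 2 + w) / 2 ^ (w + 1) := by
    rw [div_pow, ← pow_mul]
    ring_nf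
  have hratio : (1 / (w : ℝ) * (L / Real.log 2)) /
      (1 / Real.log 2 / (8 * (w : ℝ) ^ 2) * (ρ ^ w / 2) ^ (w + 1)) =
      8 * w * (2 ^ (w + 1) * L) / ρ ^ (w ^ 2 + w) := by
    rw [hpow]
    field_simp
  rw [hratio, gt_iff_lt, lt_div_iff₀ (by positivity)]
  calc (w : ℝ) * 2 ^ (w ^ 2 + w + 3) * ρ ^ (w ^ 2 + w) = 8 * w * (2 * ρ) ^ (w ^ 2 + w) := by
        rw [mul_pow, pow_add _ _ 3]
        ring
    _ < 8 * w * (2 ^ (w + 1) * L) := by gcongr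
end

section
/- Let ρ be a real number with 0 < ρ < 1/4. Then (2/3) H₄(3ρ) < ρ + (1/2) H(2ρ), where H(x) = −x log₂ x − (1−x) log₂ (1−x) and H₄(x) = x log₄ 3 − x log₄ x − (1−x) log₄ (1−x). -/
/-- for real `0 < ρ < 1/4`, `(2/3) H₄(3ρ) < ρ + (1/2) H(2ρ)`. -/
theorem quadEnt_lt_binEnt (ρ : ℝ) (hρ0 : 0 < ρ) (hρ1 : ρ < 1 / 4) :
    (2 / 3) * quadEnt (3 * ρ) < ρ + (1 / 2) * binEnt (2 * ρ) := by
  have hlog2 : 0 < Real.log 2 := Real.log_pos one_lt_two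
  have hlog4 : Real.log 4 = 2 * Real.log 2 := by
    rw [show (4 : ℝ) = 2 ^ 2 by norm_num, Real.log_pow]
    norm_num
  have hconv : (1 - 2 * ρ) * Real.log (1 - 2 * ρ) <
      2 / 3 * ((1 - 3 * ρ) * Real.log (1 - 3 * ρ)) := by
    have h := Real.strictConvexOn_mul_log.2 (x := 1 - 3 * ρ) (y := 1)
      (Set.mem_Ici.2 (by linarith)) (Set.mem_Ici.2 zero_le_one) (by linarith)
      (show (0 : ℝ) < 2 / 3 by norm_num) (show (0 : ℝ) < 1 / 3 by norm_num) (by norm_num)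
    simp only [smul_eq_mul, Real.log_one, mul_zero, add_zero] at h
    rwa [show 2 / 3 * (1 - 3 * ρ) + 1 / 3 * 1 = 1 - 2 * ρ by ring] at h
  have hdiff : ρ + (1 / 2) * binEnt (2 * ρ) - (2 / 3) * quadEnt (3 * ρ) =
      (2 / 3 * ((1 - 3 * ρ) * Real.log (1 - 3 * ρ)) - (1 - 2 * ρ) * Real.log (1 - 2 * ρ)) /
        (2 * Real.log 2) := by
    simp only [binEnt, quadEnt, Real.logb, hlog4, Real.log_mul two_ne_zero hρ0.ne',
      Real.log_mul three_ne_zero hρ0.ne']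
    field_simp
    ring
  rw [← sub_pos, hdiff]
  exact div_pos (sub_pos.2 hconv) (by positivity)
end
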